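/- For every labelled linear ordering M = (ℕ, <, P₁, …, Pₙ) there exists a set Q ⊆ ℕ such that Q is not MSO-definable in M and the MSO theory of the expansion M' = (ℕ, <, P₁, …, Pₙ, Q) is recursive in (Turing reducible to) the MSO theory of M. In particular, if MSO(M) is decidable, then MSO(M') is decidable. -/

import Mathlib

namespace Paper

/-! ## Syntax and semantics of monadic second-order logic over labelled linear orders

A labelled linear ordering `M = (A, <, P₁, …, Pₙ)` is represented by a type `A`,
a binary relation `r : A → A → Prop` (the order) and `P : Fin n → Set A`
(the unary predicates). -/

/-- MSO formulas over the signature `{<, P₀, …, P_{n-1}}`.  First-order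
variables and second-order (set) variables are both indexed by `ℕ`. -/
inductive MSO (n : ℕ) : Type
  | lt (i j : ℕ) : MSO n
  | pred (k : Fin n) (i : ℕ) : MSO n
  | mem (i j : ℕ) : MSO n
  | not (φ : MSO n) : MSO n
  | and (φ ψ : MSO n) : MSO n
  | ex1 (i : ℕ) (φ : MSO n) : MSO n
  | ex2 (j : ℕ) (φ : MSO n) : MSO n

namespace MSO

variable {n : ℕ}

/-- Satisfaction of an MSO formula in the structure `(A, r, P)` under the
first-order assignment `v` and the second-order assignment `V`. -/
def Sat {A : Type} (r : A → A → Prop) (P : Fin n → Set A)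
    (v : ℕ → A) (V : ℕ → Set A) : MSO n → Prop
  | lt i j => r (v i) (v j)
  | pred k i => v i ∈ P k
  | mem i j => v i ∈ V j
  | not φ => ¬ Sat r P v V φ
  | and φ ψ => Sat r P v V φ ∧ Sat r P v V ψ
  | ex1 i φ => ∃ a : A, Sat r P (Function.update v i a) V φ
  | ex2 j φ => ∃ S : Set A, Sat r P v (Function.update V j S) φ

/-- Quantifier depth of an MSO formula. -/
def qd : MSO n → ℕ
  | lt _ _ => 0
  | pred _ _ => 0
  | mem _ _ => 0
  | not φ => qd φ
  | and φ ψ => max (qd φ) (qd ψ)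
  | ex1 _ φ => qd φ + 1
  | ex2 _ φ => qd φ + 1

/-- Free first-order variables of an MSO formula. -/
def fv1 : MSO n → Finset ℕ
  | lt i j => {i, j}
  | pred _ i => {i}
  | mem i _ => {i}
  | not φ => fv1 φ
  | and φ ψ => fv1 φ ∪ fv1 ψ
  | ex1 i φ => fv1 φ \ {i}
  | ex2 _ φ => fv1 φ

/-- Free second-order variables of an MSO formula. -/
def fv2 : MSO n → Finset ℕ
  | lt _ _ => ∅
  | pred _ _ => ∅
  | mem _ j => {j}
  | not φ => fv2 φ
  | and φ ψ => fv2 φ ∪ fv2 ψ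
  | ex1 _ φ => fv2 φ
  | ex2 j φ => fv2 φ \ {j}

/-- A sentence is a formula with no free variables. -/
def IsSentence (φ : MSO n) : Prop := fv1 φ = ∅ ∧ fv2 φ = ∅

/-- A sentence `φ` is true in the structure `(A, r, P)`. -/
def TrueIn {A : Type} (r : A → A → Prop) (P : Fin n → Set A) (φ : MSO n) : Prop :=
  ∀ (v : ℕ → A) (V : ℕ → Set A), Sat r P v V φ

/-- `Q ⊆ A` is MSO-definable in `(A, r, P)`: there is a formula `φ(x)` whose only
free variable is the first-order variable `0` defining `Q`. -/
def Definable {A : Type} (r : A → A → Prop) (P : Fin n → Set A) (Q : Set A) : Prop :=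
  ∃ φ : MSO n, fv1 φ ⊆ {0} ∧ fv2 φ = ∅ ∧
    ∀ a : A, a ∈ Q ↔ ∀ (v : ℕ → A) (V : ℕ → Set A), Sat r P (Function.update v 0 a) V φ

/-- A Gödel numbering of MSO formulas. -/
def encode : MSO n → ℕ
  | lt i j => Nat.pair 0 (Nat.pair i j)
  | pred k i => Nat.pair 1 (Nat.pair k i)
  | mem i j => Nat.pair 2 (Nat.pair i j)
  | not φ => Nat.pair 3 (encode φ)
  | and φ ψ => Nat.pair 4 (Nat.pair (encode φ) (encode ψ))
  | ex1 i φ => Nat.pair 5 (Nat.pair i (encode φ))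
  | ex2 j φ => Nat.pair 6 (Nat.pair j (encode φ))

/-- The MSO theory of the structure `(A, r, P)`, as a set of Gödel codes of the true
sentences. -/
def TheoryCodes {A : Type} (r : A → A → Prop) (P : Fin n → Set A) : Set ℕ :=
  {c | ∃ φ : MSO n, IsSentence φ ∧ encode φ = c ∧ TrueIn r P φ}

/-- Two structures have the same `k`-type: they satisfy the same MSO sentences of
quantifier depth `≤ k`. -/
def EquivType (k : ℕ) {A B : Type} (r : A → A → Prop) (P : Fin n → Set A)
    (s : B → B → Prop) (Q : Fin n → Set B) : Prop :=
  ∀ φ : MSO n, IsSentence φ → qd φ ≤ k → (TrueIn r P φ ↔ TrueIn s Q φ)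

/-- The `k`-type of a structure, as the set of Gödel codes of the true sentences
of quantifier depth `≤ k`. -/
def TypeSet (k : ℕ) {A : Type} (r : A → A → Prop) (P : Fin n → Set A) : Set ℕ :=
  {c | ∃ φ : MSO n, IsSentence φ ∧ qd φ ≤ k ∧ encode φ = c ∧ TrueIn r P φ}

end MSO

/-- The order relation of the substructure with domain `S`. -/
def subRel {A : Type} (r : A → A → Prop) (S : Set A) : S → S → Prop :=
  fun x y => r x y

/-- The predicates of the substructure with domain `S`. -/
def subPred {A : Type} {n : ℕ} (P : Fin n → Set A) (S : Set A) : Fin n → Set S :=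
  fun k => {x : S | (x : A) ∈ P k}

/-! ## Relative computability -/

/-- Partial recursiveness relative to an oracle `O` (Kleene-style, following
the definition of `Nat.Partrec`, with an extra base case for the oracle). -/
inductive RecursiveIn (O : ℕ →. ℕ) : (ℕ →. ℕ) → Prop
  | zero : RecursiveIn O (pure 0)
  | succ : RecursiveIn O ↑Nat.succ
  | left : RecursiveIn O ↑fun n : ℕ => n.unpair.1
  | right : RecursiveIn O ↑fun n : ℕ => n.unpair.2
  | oracle : RecursiveIn O O
  | pair {f g} : RecursiveIn O f → RecursiveIn O g →
      RecursiveIn O fun n => Nat.pair <$> f n <*> g n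
  | comp {f g} : RecursiveIn O f → RecursiveIn O g →
      RecursiveIn O fun n => g n >>= f
  | prec {f g} : RecursiveIn O f → RecursiveIn O g →
      RecursiveIn O (Nat.unpaired fun a m =>
        m.rec (f a) fun y IH => do let i ← IH; g (Nat.pair a (Nat.pair y i)))
  | rfind {f} : RecursiveIn O f →
      RecursiveIn O fun a => Nat.rfind fun m => (fun x => x = 0) <$> f (Nat.pair a m)

/-- The characteristic (partial) function of a set of naturals. -/
noncomputable def chi (S : Set ℕ) : ℕ →. ℕ :=
  fun m => Part.some (S.indicator (fun _ => 1) m)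

/-- `S` is recursive in (Turing reducible to) `T`. -/
def TuringRed (S T : Set ℕ) : Prop := RecursiveIn (chi T) (chi S)

/-- The (recursive) join of a finite family of sets of naturals. -/
def finJoin {m : ℕ} (P : Fin m → Set ℕ) : Set ℕ :=
  {c | ∃ i : Fin m, ∃ x : ℕ, c = Nat.pair i x ∧ x ∈ P i}

/-- The (recursive) join of two sets of naturals. -/
def setJoin (S T : Set ℕ) : Set ℕ :=
  {c | (∃ a, c = 2 * a ∧ a ∈ S) ∨ (∃ a, c = 2 * a + 1 ∧ a ∈ T)}

/-- A set of naturals is decidable (computable). -/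
def DecidableSet (S : Set ℕ) : Prop := ComputablePred (· ∈ S)

/-! ## Homogeneous sets for labelled orderings of the naturals -/

/-- `H = {h 0 < h 1 < ⋯}` is `k`-homogeneous for `(ℕ, <, P)`:
all substructures `M_{[h i, h j)}`, `i < j`, have the same `k`-type. -/
def KHomogeneous {n : ℕ} (P : Fin n → Set ℕ) (h : ℕ → ℕ) (k : ℕ) : Prop :=
  ∀ i j i' j' : ℕ, i < j → i' < j' →
    MSO.EquivType k
      (subRel (· < ·) (Set.Ico (h i) (h j))) (subPred P (Set.Ico (h i) (h j)))
      (subRel (· < ·) (Set.Ico (h i') (h j'))) (subPred P (Set.Ico (h i') (h j')))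

/-- `H = {h 0 < h 1 < ⋯}` is uniformly homogeneous for `(ℕ, <, P)`:
for each `k`, the set `{h k < h (k+1) < ⋯}` is `k`-homogeneous. -/
def UniformlyHomogeneous {n : ℕ} (P : Fin n → Set ℕ) (h : ℕ → ℕ) : Prop :=
  StrictMono h ∧
  ∀ k : ℕ, KHomogeneous P (fun i => h (k + i)) k

/-! ## ℤ-words -/

/-- The finite word `u` occurs at position `i` in the `ℤ`-word `w`. -/
def OccursAt {σ : Type} (w : ℤ → σ) (u : List σ) (i : ℤ) : Prop :=
  ∀ k : Fin u.length, w (i + (k : ℕ)) = u.get k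

/-- The finite word `u` occurs in the `ℤ`-word `w`. -/
def OccursIn {σ : Type} (w : ℤ → σ) (u : List σ) : Prop :=
  ∃ i : ℤ, OccursAt w u i

/-- `u` occurs in every prefix of `w`. -/
def InEveryPrefix {σ : Type} (w : ℤ → σ) (u : List σ) : Prop :=
  ∀ n : ℤ, ∃ i : ℤ, i + u.length ≤ n ∧ OccursAt w u i

/-- `u` occurs in every suffix of `w`. -/
def InEverySuffix {σ : Type} (w : ℤ → σ) (u : List σ) : Prop :=
  ∀ n : ℤ, ∃ i : ℤ, n ≤ i ∧ OccursAt w u i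

/-- A `ℤ`-word `w` is recurrent: for every regular language `X`, either no element
of `X` occurs in `w`, or every prefix and every suffix of `w` contains an
occurrence of some element of `X`. -/
def Recurrent {σ : Type} (w : ℤ → σ) : Prop :=
  ∀ X : Language σ, X.IsRegular →
    (∀ u ∈ X, ¬ OccursIn w u) ∨
    (∀ n : ℤ, (∃ u ∈ X, ∃ i : ℤ, i + u.length ≤ n ∧ OccursAt w u i) ∧
              (∃ u ∈ X, ∃ i : ℤ, n ≤ i ∧ OccursAt w u i))

/-- The `ℤ`-word `w(M)` over the alphabet `{0,1}ⁿ` associated with the labelled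
linear ordering `M = (ℤ, <, P₁, …, Pₙ)`. -/
def wordOf {n : ℕ} (P : Fin n → Set ℤ) : ℤ → (Fin n → Prop) :=
  fun i k => i ∈ P k

end Paper

namespace Paper

namespace MSO

variable {n : ℕ}

theorem encode_injective : Function.Injective (encode (n := n)) := by
  intro φ
  induction φ with
  | lt i j => intro ψ h; cases ψ <;> simp_all [encode]
  | pred k i => intro ψ h; cases ψ <;> simp_all [encode, Fin.ext_iff]
  | mem i j => intro ψ h; cases ψ <;> simp_all [encode]
  | not φ ih =>
    intro ψ h
    cases ψ <;> simp [encode] at h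
    rw [ih h]
  | and φ χ ih₁ ih₂ =>
    intro ψ h
    cases ψ <;> simp [encode] at h
    rw [ih₁ h.1, ih₂ h.2]
  | ex1 i φ ih =>
    intro ψ h
    cases ψ <;> simp [encode] at h
    rw [ih h.2, h.1]
  | ex2 i φ ih =>
    intro ψ h
    cases ψ <;> simp [encode] at h
    rw [ih h.2, h.1]

theorem encode_eq_not {φ : MSO n} {c : ℕ} (h : encode φ = Nat.pair 3 c) :
    ∃ ψ, φ = not ψ ∧ encode ψ = c := by
  cases φ <;> simp [encode] at h
  exact ⟨_, rfl, h⟩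

theorem encode_eq_and {φ : MSO n} {c d : ℕ} (h : encode φ = Nat.pair 4 (Nat.pair c d)) :
    ∃ ψ χ, φ = and ψ χ ∧ encode ψ = c ∧ encode χ = d := by
  cases φ <;> simp [encode] at h
  exact ⟨_, _, rfl, h.1, h.2⟩

theorem encode_eq_ex1 {φ : MSO n} {i c : ℕ} (h : encode φ = Nat.pair 5 (Nat.pair i c)) :
    ∃ ψ, φ = ex1 i ψ ∧ encode ψ = c := by
  cases φ <;> simp [encode] at h
  obtain ⟨rfl, h⟩ := h
  exact ⟨_, rfl, h⟩

theorem encode_eq_ex2 {φ : MSO n} {j c : ℕ} (h : encode φ = Nat.pair 6 (Nat.pair j c)) :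
    ∃ ψ, φ = ex2 j ψ ∧ encode ψ = c := by
  cases φ <;> simp [encode] at h
  obtain ⟨rfl, h⟩ := h
  exact ⟨_, rfl, h⟩

/-- Satisfaction only depends on the values of the free variables. -/
theorem sat_congr {A : Type} {r : A → A → Prop} {P : Fin n → Set A} {φ : MSO n} :
    ∀ {v v' : ℕ → A} {V V' : ℕ → Set A}, (∀ i ∈ fv1 φ, v i = v' i) → (∀ j ∈ fv2 φ, V j = V' j) →
      (Sat r P v V φ ↔ Sat r P v' V' φ) := by
  induction φ with
  | lt i j => intro v v' V V' h₁ h₂; simp_all [Sat, fv1]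
  | pred k i => intro v v' V V' h₁ h₂; simp_all [Sat, fv1]
  | mem i j => intro v v' V V' h₁ h₂; simp_all [Sat, fv1, fv2]
  | not φ ih => intro v v' V V' h₁ h₂; exact not_congr (ih h₁ h₂)
  | and φ ψ ih₁ ih₂ =>
    intro v v' V V' h₁ h₂
    simp only [fv1, fv2, Finset.mem_union] at h₁ h₂
    exact and_congr (ih₁ (fun i hi => h₁ i (.inl hi)) fun i hi => h₂ i (.inl hi))
      (ih₂ (fun i hi => h₁ i (.inr hi)) fun i hi => h₂ i (.inr hi))
  | ex1 i φ ih =>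
    intro v v' V V' h₁ h₂
    refine exists_congr fun a => ih (fun k hk => ?_) h₂
    by_cases hki : k = i
    · simp [hki]
    · simpa [hki] using h₁ k (by simp [fv1, hk, hki])
  | ex2 i φ ih =>
    intro v v' V V' h₁ h₂
    refine exists_congr fun a => ih h₁ (fun k hk => ?_)
    by_cases hki : k = i
    · simp [hki]
    · simpa [hki] using h₂ k (by simp [fv2, hk, hki])

/-- The formula `s ≤ x₀`. -/
def geNum : ℕ → MSO n
  | 0 => not (lt 0 0)
  | s + 1 => ex1 1 (and (lt 1 0) (ex1 0 (and (and (not (lt 0 1)) (not (lt 1 0))) (geNum s))))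

/-- The formula stating that the set `X₀` is infinite. -/
def infin : MSO n := not (ex1 0 (not (ex1 1 (and (lt 0 1) (mem 1 0)))))

/-- The formula `s ∈ X₀`. -/
def numMem (s : ℕ) : MSO n := ex1 0 (and (mem 0 0) (and (geNum s) (not (geNum (s + 1)))))

/-- The formula stating that no pair `x₀ < x₁` of elements of `X₀` above `s` satisfies `χ`. -/
def avoid (s : ℕ) (χ : MSO n) : MSO n :=
  not (ex1 0 (ex1 1 (and (and (and (mem 0 0) (mem 1 0)) (and (lt 0 1) (geNum (s + 1))))
    (ex2 0 χ))))

theorem fv1_geNum (s : ℕ) : fv1 (geNum s : MSO n) ⊆ {0} := by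
  induction s with
  | zero => simp [geNum, fv1]
  | succ s ih =>
    simp only [geNum, fv1]
    intro x hx
    have := @ih x
    simp only [Finset.mem_sdiff, Finset.mem_union, Finset.mem_insert, Finset.mem_singleton] at *
    tauto

theorem fv2_geNum (s : ℕ) : fv2 (geNum s : MSO n) = ∅ := by
  induction s with
  | zero => simp [geNum, fv2]
  | succ s ih => simp [geNum, fv2, ih]

variable {P : Fin n → Set ℕ} {v : ℕ → ℕ} {V : ℕ → Set ℕ}

theorem sat_geNum (s : ℕ) : ∀ {v : ℕ → ℕ},
    (Sat (fun x y : ℕ => x < y) P v V (geNum s) ↔ s ≤ v 0) := by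
  induction s with
  | zero => simp [geNum, Sat]
  | succ s ih =>
    intro v
    simp only [geNum, Sat, ih]
    simp only [Function.update_self, ne_eq, zero_ne_one, not_false_eq_true, Function.update_of_ne,
      one_ne_zero, not_lt]
    constructor
    · rintro ⟨b, hb, a, ⟨h₁, h₂⟩, h⟩
      omega
    · intro h
      exact ⟨s, h, s, ⟨le_rfl, le_rfl⟩, le_rfl⟩

theorem sat_infin : Sat (fun x y : ℕ => x < y) P v V infin ↔ (V 0).Infinite := by
  simp [infin, Sat, Set.infinite_iff_exists_gt, and_comm]

theorem sat_numMem (s : ℕ) : Sat (fun x y : ℕ => x < y) P v V (numMem s) ↔ s ∈ V 0 := by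
  simp only [numMem, Sat, sat_geNum, Function.update_self]
  constructor
  · rintro ⟨a, ha, h₁, h₂⟩
    obtain rfl : a = s := by omega
    exact ha
  · exact fun h => ⟨s, h, le_rfl, by omega⟩

theorem sat_avoid (s : ℕ) (χ : MSO n) :
    Sat (fun x y : ℕ => x < y) P v V (avoid s χ) ↔ ∀ x ∈ V 0, ∀ y ∈ V 0, x < y → s < x →
      ¬ Sat (fun x y : ℕ => x < y) P (Function.update (Function.update v 0 x) 1 y) V (ex2 0 χ) := by
  rw [avoid]
  simp only [Sat, sat_geNum, Function.update_self, ne_eq, zero_ne_one, not_false_eq_true,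
    Function.update_of_ne, not_exists, not_and, and_imp]
  constructor
  · intro h x hx y hy hxy hs
    exact h x y hx hy hxy hs
  · intro h x y hx hy hxy hs
    exact h x hx y hy hxy hs

end MSO
end Paper

namespace Paper

/-- Infinite Ramsey theorem for pairs and two colours. -/
theorem exists_infinite_homogeneous (R : ℕ → ℕ → Prop) {X : Set ℕ} (hX : X.Infinite) :
    ∃ H ⊆ X, H.Infinite ∧ ((∀ x ∈ H, ∀ y ∈ H, x < y → R x y) ∨
      ∀ x ∈ H, ∀ y ∈ H, x < y → ¬ R x y) := by
  have hne : (Filter.atTop ⊓ Filter.principal X).NeBot :=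
    Filter.frequently_mem_iff_neBot.1 (Nat.frequently_atTop_iff_infinite.2 hX)
  obtain ⟨U, hU⟩ := Ultrafilter.exists_le (Filter.atTop ⊓ Filter.principal X)
  have hUX : X ∈ U := hU (Filter.mem_inf_of_right (Filter.mem_principal_self X))
  have hUt : ∀ t, Set.Ioi t ∈ U := fun t => hU (Filter.mem_inf_of_left (Filter.Ioi_mem_atTop t))
  have key : ∀ S : ℕ → ℕ → Prop, {x | {y | S x y} ∈ U} ∈ U →
      ∃ H ⊆ X, H.Infinite ∧ ∀ x ∈ H, ∀ y ∈ H, x < y → S x y := by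
    intro S hS
    obtain ⟨f, hf₁, hf₂⟩ := exists_seq_of_forall_finset_exists
      (fun x => x ∈ X ∧ {y | S x y} ∈ U) (fun x y => x < y ∧ S x y) (by
        intro s hs
        have h : (⋂ x ∈ s, ({y | S x y} ∩ Set.Ioi x)) ∩ (X ∩ {x | {y | S x y} ∈ U}) ∈ U := by
          refine Filter.inter_mem ?_ (Filter.inter_mem hUX hS)
          exact (Filter.biInter_finset_mem s).2 fun x hx =>
            Filter.inter_mem (hs x hx).2 (hUt x)
        obtain ⟨y, hy₁, hy₂⟩ := U.nonempty_of_mem h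
        simp only [Set.mem_iInter] at hy₁
        exact ⟨y, hy₂, fun x hx => ⟨(hy₁ x hx).2, (hy₁ x hx).1⟩⟩)
    have hmono : StrictMono f := fun a b hab => (hf₂ a b hab).1
    refine ⟨Set.range f, ?_, Set.infinite_range_of_injective hmono.injective, ?_⟩
    · rintro _ ⟨a, rfl⟩
      exact (hf₁ a).1
    · rintro _ ⟨a, rfl⟩ _ ⟨b, rfl⟩ hab
      exact (hf₂ a b (hmono.lt_iff_lt.1 hab)).2
  rcases Ultrafilter.mem_or_compl_mem U {x | {y | R x y} ∈ U} with h | h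
  · obtain ⟨H, h₁, h₂, h₃⟩ := key R h
    exact ⟨H, h₁, h₂, .inl h₃⟩
  · obtain ⟨H, h₁, h₂, h₃⟩ := key (fun x y => ¬ R x y)
      (Filter.mem_of_superset h fun x hx => Ultrafilter.compl_mem_iff_notMem.2 hx)
    exact ⟨H, h₁, h₂, .inr h₃⟩

open MSO

variable {n : ℕ}

/-- `c` is the code of a formula whose only free variable is `X₀`. -/
def IsSetCode (n c : ℕ) : Prop := ∃ θ : MSO n, encode θ = c ∧ fv1 θ = ∅ ∧ fv2 θ ⊆ {0}

/-- The family of sets satisfying the formula in the free variable `X₀` with code `c`. -/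
def Models (P : Fin n → Set ℕ) (c : ℕ) : Set (Set ℕ) :=
  {X | ∃ θ : MSO n, encode θ = c ∧ fv1 θ = ∅ ∧ fv2 θ ⊆ {0} ∧
    Sat (fun x y : ℕ => x < y) P (fun _ => 0) (fun _ => X) θ}

variable {P : Fin n → Set ℕ}

theorem mem_models_encode {θ : MSO n} (h₁ : fv1 θ = ∅) (h₂ : fv2 θ ⊆ {0}) {X : Set ℕ} :
    X ∈ Models P (encode θ) ↔
      Sat (fun x y : ℕ => x < y) P (fun _ => 0) (fun _ => X) θ := by
  constructor
  · rintro ⟨θ', h, -, -, hs⟩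
    rwa [← encode_injective h]
  · exact fun h => ⟨θ, rfl, h₁, h₂, h⟩

theorem isSetCode_of_mem {c : ℕ} {X : Set ℕ} (h : X ∈ Models P c) : IsSetCode n c := by
  obtain ⟨θ, h₁, h₂, h₃, -⟩ := h
  exact ⟨θ, h₁, h₂, h₃⟩

theorem isSetCode_not {c : ℕ} : IsSetCode n (Nat.pair 3 c) ↔ IsSetCode n c := by
  constructor
  · rintro ⟨θ, h₁, h₂, h₃⟩
    obtain ⟨ψ, rfl, rfl⟩ := encode_eq_not h₁
    exact ⟨ψ, rfl, h₂, h₃⟩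
  · rintro ⟨θ, rfl, h₂, h₃⟩
    exact ⟨not θ, rfl, h₂, h₃⟩

theorem isSetCode_and {c d : ℕ} :
    IsSetCode n (Nat.pair 4 (Nat.pair c d)) ↔ IsSetCode n c ∧ IsSetCode n d := by
  constructor
  · rintro ⟨θ, h₁, h₂, h₃⟩
    obtain ⟨ψ, χ, rfl, rfl, rfl⟩ := encode_eq_and h₁
    simp only [fv1, Finset.union_eq_empty] at h₂
    simp only [fv2, Finset.union_subset_iff] at h₃
    exact ⟨⟨ψ, rfl, h₂.1, h₃.1⟩, ⟨χ, rfl, h₂.2, h₃.2⟩⟩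
  · rintro ⟨⟨ψ, rfl, h₁, h₂⟩, ⟨χ, rfl, h₃, h₄⟩⟩
    exact ⟨and ψ χ, rfl, by simp [fv1, h₁, h₃], Finset.union_subset h₂ h₄⟩

theorem mem_models_not {c : ℕ} {X : Set ℕ} :
    X ∈ Models P (Nat.pair 3 c) ↔ IsSetCode n c ∧ X ∉ Models P c := by
  constructor
  · intro h
    obtain ⟨θ, rfl, h₁, h₂⟩ := isSetCode_not.1 (isSetCode_of_mem h)
    refine ⟨⟨θ, rfl, h₁, h₂⟩, fun h' => ?_⟩
    rw [mem_models_encode h₁ h₂] at h'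
    exact (mem_models_encode (θ := not θ) h₁ h₂).1 h h'
  · rintro ⟨⟨θ, rfl, h₁, h₂⟩, h⟩
    rw [mem_models_encode h₁ h₂] at h
    exact (mem_models_encode (θ := not θ) h₁ h₂).2 h

theorem models_and {c d : ℕ} :
    Models P (Nat.pair 4 (Nat.pair c d)) = Models P c ∩ Models P d := by
  ext X
  constructor
  · rintro ⟨θ, h₁, h₂, h₃, h₄⟩
    obtain ⟨ψ, χ, rfl, rfl, rfl⟩ := encode_eq_and h₁
    simp only [fv1, Finset.union_eq_empty] at h₂
    simp only [fv2, Finset.union_subset_iff] at h₃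
    exact ⟨⟨ψ, rfl, h₂.1, h₃.1, h₄.1⟩, ⟨χ, rfl, h₂.2, h₃.2, h₄.2⟩⟩
  · rintro ⟨⟨ψ, rfl, h₁, h₂, h₅⟩, ⟨χ, rfl, h₃, h₄, h₆⟩⟩
    exact ⟨and ψ χ, rfl, by simp [fv1, h₁, h₃], Finset.union_subset h₂ h₄,
      h₅, h₆⟩

theorem trueIn_iff_sat {φ : MSO n} (h : IsSentence φ) (v : ℕ → ℕ) (V : ℕ → Set ℕ) :
    TrueIn (fun x y : ℕ => x < y) P φ ↔ Sat (fun x y : ℕ => x < y) P v V φ := by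
  refine ⟨fun h' => h' v V, fun h' v' V' => ?_⟩
  refine (sat_congr ?_ ?_).1 h' <;> simp [h.1, h.2]

theorem mem_theory_ex2 {c : ℕ} :
    Nat.pair 6 (Nat.pair 0 c) ∈ TheoryCodes (fun x y : ℕ => x < y) P ↔
      (Models P c).Nonempty := by
  have key : ∀ θ : MSO n, fv2 θ ⊆ {0} →
      ((∃ X : Set ℕ, Sat (fun x y : ℕ => x < y) P (fun _ => 0)
        (Function.update (fun _ => ∅) 0 X) θ) ↔
      ∃ X : Set ℕ, Sat (fun x y : ℕ => x < y) P (fun _ => 0) (fun _ => X) θ) := by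
    intro θ h
    refine exists_congr fun X => sat_congr (fun _ _ => rfl) fun j hj => ?_
    simp [Finset.mem_singleton.1 (h hj)]
  constructor
  · rintro ⟨φ, hφ, he, ht⟩
    obtain ⟨ψ, rfl, rfl⟩ := encode_eq_ex2 he
    have h₁ : fv1 ψ = ∅ := hφ.1
    have h₂ : fv2 ψ ⊆ {0} := Finset.sdiff_eq_empty_iff_subset.1 hφ.2
    rw [trueIn_iff_sat hφ (fun _ => 0) (fun _ => ∅)] at ht
    obtain ⟨X, hX⟩ := (key ψ h₂).1 ht
    exact ⟨X, ψ, rfl, h₁, h₂, hX⟩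
  · rintro ⟨X, ψ, rfl, h₁, h₂, hX⟩
    have hs : IsSentence (ex2 0 ψ) := ⟨h₁, Finset.sdiff_eq_empty_iff_subset.2 h₂⟩
    refine ⟨ex2 0 ψ, hs, rfl, ?_⟩
    rw [trueIn_iff_sat hs (fun _ => 0) (fun _ => ∅)]
    exact (key ψ h₂).2 ⟨X, hX⟩

theorem mem_theory_not_ex2 {c : ℕ} :
    Nat.pair 3 (Nat.pair 6 (Nat.pair 0 c)) ∈ TheoryCodes (fun x y : ℕ => x < y) P ↔
      IsSetCode n c ∧ ¬ (Models P c).Nonempty := by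
  rw [← mem_theory_ex2]
  constructor
  · rintro ⟨φ, hφ, he, ht⟩
    obtain ⟨ψ, rfl, he₁⟩ := encode_eq_not he
    obtain ⟨θ, rfl, rfl⟩ := encode_eq_ex2 he₁
    refine ⟨⟨θ, rfl, hφ.1, Finset.sdiff_eq_empty_iff_subset.1 hφ.2⟩, ?_⟩
    rintro ⟨χ, hχ, he', ht'⟩
    obtain rfl : χ = ex2 0 θ := encode_injective he'
    exact ht (fun _ => 0) (fun _ => ∅) (ht' _ _)
  · rintro ⟨⟨θ, rfl, h₁, h₂⟩, h⟩
    have hs : IsSentence (ex2 0 θ) := ⟨h₁, Finset.sdiff_eq_empty_iff_subset.2 h₂⟩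
    have hs' : IsSentence (not (ex2 0 θ)) := hs
    refine ⟨not (ex2 0 θ), hs', rfl, ?_⟩
    rw [trueIn_iff_sat hs' (fun _ => 0) (fun _ => ∅)]
    intro h'
    exact h ⟨_, hs, rfl, (trueIn_iff_sat hs _ _).2 h'⟩

theorem models_infin : Models P (encode (infin : MSO n)) = {X | X.Infinite} := by
  ext X
  rw [mem_models_encode (by simp [infin, fv1]) (by simp [infin, fv2]), sat_infin]
  rfl

theorem isSetCode_numMem (s : ℕ) : IsSetCode n (encode (numMem s : MSO n)) := by
  refine ⟨_, rfl, ?_, ?_⟩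
  · have h₁ := fv1_geNum (n := n) s
    have h₂ := fv1_geNum (n := n) (s + 1)
    exact Finset.sdiff_eq_empty_iff_subset.2
      (Finset.union_subset (by simp [fv1]) (Finset.union_subset h₁ h₂))
  · simp [numMem, fv2, fv2_geNum]

theorem models_numMem (s : ℕ) : Models P (encode (numMem s : MSO n)) = {X | s ∈ X} := by
  ext X
  obtain ⟨θ, h₁, h₂, h₃⟩ := isSetCode_numMem (n := n) s
  obtain rfl := encode_injective h₁
  rw [mem_models_encode h₂ h₃, sat_numMem]
  rfl

/-- The code of `avoid s χ` as a function of the code of `χ`. -/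
def avoidCode (n s c : ℕ) : ℕ :=
  Nat.pair 3 (Nat.pair 5 (Nat.pair 0 (Nat.pair 5 (Nat.pair 1 (Nat.pair 4 (Nat.pair
    (encode (and (and (mem 0 0) (mem 1 0)) (and (lt 0 1) (geNum (s + 1))) : MSO n))
    (Nat.pair 6 (Nat.pair 0 c))))))))

/-- The relation between `x₀` and `x₁` defined by `∃ X₀, χ`. -/
def PairRel (P : Fin n → Set ℕ) (χ : MSO n) (x y : ℕ) : Prop :=
  Sat (fun x y : ℕ => x < y) P (Function.update (Function.update (fun _ => 0) 0 x) 1 y)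
    (fun _ => ∅) (ex2 0 χ)

theorem mem_models_avoidCode {s c : ℕ} {X : Set ℕ} :
    X ∈ Models P (avoidCode n s c) ↔
      ∃ χ : MSO n, encode χ = c ∧ fv1 χ ⊆ {0, 1} ∧ fv2 χ ⊆ {0} ∧
        ∀ x ∈ X, ∀ y ∈ X, x < y → s < x → ¬ PairRel P χ x y := by
  have fvs : ∀ χ : MSO n, fv1 (avoid s χ) = ∅ ↔ fv1 χ ⊆ {0, 1} := by
    intro χ
    have h := fv1_geNum (n := n) (s + 1)
    rw [← Finset.subset_empty]
    simp only [avoid, fv1, Finset.subset_iff, Finset.mem_sdiff, Finset.mem_union,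
      Finset.mem_insert, Finset.mem_singleton, Finset.notMem_empty] at h ⊢
    refine forall_congr' fun a => ?_
    have := @h a
    tauto
  have sub : ∀ χ : MSO n, fv2 (avoid s χ) ⊆ {0} ↔ fv2 χ ⊆ {0} := by
    intro χ
    simp only [avoid, fv2, fv2_geNum, Finset.subset_iff, Finset.mem_sdiff, Finset.mem_union,
      Finset.mem_singleton, Finset.notMem_empty]
    refine forall_congr' fun a => ?_
    tauto
  have hsat : ∀ χ : MSO n, fv2 χ ⊆ {0} →
      (Sat (fun x y : ℕ => x < y) P (fun _ => 0) (fun _ => X) (avoid s χ) ↔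
        ∀ x ∈ X, ∀ y ∈ X, x < y → s < x → ¬ PairRel P χ x y) := by
    intro χ h
    rw [sat_avoid]
    refine forall₂_congr fun x _ => forall₂_congr fun y _ => forall₂_congr fun _ _ =>
      not_congr (sat_congr (fun _ _ => rfl) fun j hj => ?_)
    simp [fv2, Finset.sdiff_eq_empty_iff_subset.2 h] at hj
  constructor
  · rintro ⟨θ, he, h₁, h₂, h₃⟩
    rw [avoidCode] at he
    obtain ⟨ψ₁, rfl, he₁⟩ := encode_eq_not he
    obtain ⟨ψ₂, rfl, he₂⟩ := encode_eq_ex1 he₁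
    obtain ⟨ψ₃, rfl, he₃⟩ := encode_eq_ex1 he₂
    obtain ⟨ψ₄, ψ₅, rfl, he₄, he₅⟩ := encode_eq_and he₃
    obtain rfl := encode_injective he₄
    obtain ⟨χ, rfl, rfl⟩ := encode_eq_ex2 he₅
    exact ⟨χ, rfl, (fvs χ).1 h₁, (sub χ).1 h₂, (hsat χ ((sub χ).1 h₂)).1 h₃⟩
  · rintro ⟨χ, rfl, h₁, h₂, h₃⟩
    exact ⟨avoid s χ, rfl, (fvs χ).2 h₁, (sub χ).2 h₂, (hsat χ h₂).2 h₃⟩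

end Paper

namespace Paper
open MSO

variable {n : ℕ}

/-- The code of the conjunction of two formulas. -/
def andCode (c d : ℕ) : ℕ := Nat.pair 4 (Nat.pair c d)

open Classical in
/-- Strengthen `c` by making the pairs above `s` homogeneous for the formula with code `k`,
whenever this is consistent. -/
noncomputable def homogenize (P : Fin n → Set ℕ) (s k c : ℕ) : ℕ :=
  if (Models P (andCode c (avoidCode n s k))).Nonempty then andCode c (avoidCode n s k)
  else if (Models P (andCode c (avoidCode n s (Nat.pair 3 k)))).Nonempty then
    andCode c (avoidCode n s (Nat.pair 3 k))
  else c

open Classical in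
/-- The approximations of the set under construction: at stage `s` the first component counts the
elements found so far, and the second one is the code of the conjunction of all constraints
imposed so far. -/
noncomputable def stage (P : Fin n → Set ℕ) : ℕ → ℕ × ℕ
  | 0 => (0, encode (infin : MSO n))
  | s + 1 =>
    if (Models P (andCode (stage P s).2 (encode (numMem s : MSO n)))).Nonempty then
      ((stage P s).1 + 1,
        homogenize P s (stage P s).1 (andCode (stage P s).2 (encode (numMem s : MSO n))))
    else ((stage P s).1, andCode (stage P s).2 (Nat.pair 3 (encode (numMem s : MSO n))))

/-- The sets satisfying all constraints imposed before stage `s`. -/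
noncomputable def approx (P : Fin n → Set ℕ) (s : ℕ) : Set (Set ℕ) := Models P (stage P s).2

/-- The set determined by the constraints of all stages. -/
noncomputable def limitSet (P : Fin n → Set ℕ) : Set ℕ := {s | ∀ X ∈ approx P (s + 1), s ∈ X}

/-- Properties of the constraints at stage `s`: they are consistent, decide membership below `s`,
are inherited by infinite subsets with the same elements below `s`, and are topologically closed
among infinite sets. -/
structure IsStage (P : Fin n → Set ℕ) (s c : ℕ) : Prop where
  nonempty : (Models P c).Nonempty
  infinite : ∀ X ∈ Models P c, X.Infinite
  decided : ∀ X ∈ Models P c, ∀ Y ∈ Models P c, ∀ t < s, t ∈ X → t ∈ Y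
  thin : ∀ X ∈ Models P c, ∀ Y ⊆ X, Y.Infinite → (∀ t < s, t ∈ X → t ∈ Y) → Y ∈ Models P c
  closed : ∀ Y : Set ℕ, Y.Infinite → (∀ t, ∃ X ∈ Models P c, ∀ u < t, u ∈ X ↔ u ∈ Y) →
    Y ∈ Models P c

variable {P : Fin n → Set ℕ}

theorem models_andCode {c d : ℕ} : Models P (andCode c d) = Models P c ∩ Models P d := models_and

theorem IsStage.isSetCode {s c : ℕ} (h : IsStage P s c) : IsSetCode n c :=
  isSetCode_of_mem h.nonempty.some_mem

theorem isStage_zero : IsStage P 0 (encode (infin : MSO n)) := by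
  refine ⟨?_, ?_, ?_, ?_, ?_⟩ <;> simp only [models_infin]
  · exact ⟨Set.univ, Set.infinite_univ⟩
  · exact fun X hX => hX
  · simp
  · exact fun X _ Y _ hY _ => hY
  · exact fun Y hY _ => hY

theorem IsStage.and_avoid {s t k c : ℕ} (h : IsStage P s c)
    (hne : (Models P (andCode c (avoidCode n t k))).Nonempty) :
    IsStage P s (andCode c (avoidCode n t k)) := by
  simp only [models_andCode] at hne
  refine ⟨?_, ?_, ?_, ?_, ?_⟩ <;> simp only [models_andCode]
  · exact hne
  · exact fun X hX => h.infinite X hX.1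
  · exact fun X hX Y hY => h.decided X hX.1 Y hY.1
  · intro X hX Y hYX hY hs
    refine ⟨h.thin X hX.1 Y hYX hY hs, ?_⟩
    obtain ⟨χ, h₁, h₂, h₃, h₄⟩ := mem_models_avoidCode.1 hX.2
    exact mem_models_avoidCode.2 ⟨χ, h₁, h₂, h₃, fun x hx y hy => h₄ x (hYX hx) y (hYX hy)⟩
  · intro Y hY hcl
    refine ⟨h.closed Y hY fun t => (hcl t).imp fun X hX => ⟨hX.1.1, hX.2⟩, ?_⟩
    obtain ⟨X, hX⟩ := hne
    obtain ⟨χ, h₁, h₂, h₃, -⟩ := mem_models_avoidCode.1 hX.2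
    refine mem_models_avoidCode.2 ⟨χ, h₁, h₂, h₃, fun x hx y hy hxy => ?_⟩
    obtain ⟨Z, ⟨-, hZ⟩, hZY⟩ := hcl (y + 1)
    obtain ⟨χ', h₁', -, -, h₄⟩ := mem_models_avoidCode.1 hZ
    obtain rfl : χ' = χ := encode_injective (h₁'.trans h₁.symm)
    exact h₄ x ((hZY x (by omega)).2 hx) y ((hZY y (by omega)).2 hy) hxy

theorem IsStage.homogenize {s t k c : ℕ} (h : IsStage P s c) :
    IsStage P s (homogenize P t k c) := by
  unfold Paper.homogenize
  split_ifs with h₁ h₂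
  · exact h.and_avoid h₁
  · exact h.and_avoid h₂
  · exact h

theorem models_homogenize_subset {s k c : ℕ} : Models P (homogenize P s k c) ⊆ Models P c := by
  unfold homogenize
  split_ifs
  · rw [models_andCode]; exact Set.inter_subset_left
  · rw [models_andCode]; exact Set.inter_subset_left
  · exact subset_rfl

theorem mem_models_not_numMem {s : ℕ} {X : Set ℕ} :
    X ∈ Models P (Nat.pair 3 (encode (numMem s : MSO n))) ↔ s ∉ X := by
  simp [mem_models_not, isSetCode_numMem, models_numMem]

theorem IsStage.succ_of_decided {s c d : ℕ} {b : Prop} (h : IsStage P s c)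
    (hd : ∀ X, X ∈ Models P d ↔ (s ∈ X ↔ b)) (hne : (Models P (andCode c d)).Nonempty) :
    IsStage P (s + 1) (andCode c d) := by
  simp only [models_andCode] at hne
  refine ⟨?_, ?_, ?_, ?_, ?_⟩ <;> simp only [models_andCode, Set.mem_inter_iff, hd]
  · exact hne
  · exact fun X hX => h.infinite X hX.1
  · intro X hX Y hY t ht htX
    rcases Nat.lt_succ_iff_lt_or_eq.1 ht with ht | rfl
    · exact h.decided X hX.1 Y hY.1 t ht htX
    · exact hY.2.2 (hX.2.1 htX)
  · intro X hX Y hYX hY hs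
    refine ⟨h.thin X hX.1 Y hYX hY fun t ht => hs t (by omega), ?_⟩
    exact (Iff.intro (fun h => hYX h) (hs s (by omega))).trans hX.2
  · intro Y hY hcl
    refine ⟨h.closed Y hY fun t => (hcl t).imp fun X hX => ⟨hX.1.1, hX.2⟩, ?_⟩
    obtain ⟨X, hX, hXY⟩ := hcl (s + 1)
    exact (hXY s (by omega)).symm.trans hX.2

theorem isStage_stage (s : ℕ) : IsStage P s (stage P s).2 := by
  induction s with
  | zero => exact isStage_zero
  | succ s ih =>
    rw [stage]
    split_ifs with h <;> dsimp only
    · exact (ih.succ_of_decided (b := True) (by simp [models_numMem]) h).homogenize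
    · refine ih.succ_of_decided (b := False) (by simp [mem_models_not_numMem]) ?_
      obtain ⟨X, hX⟩ := ih.nonempty
      rw [models_andCode] at h ⊢
      refine ⟨X, hX, mem_models_not_numMem.2 fun hs => h ⟨X, hX, ?_⟩⟩
      rwa [models_numMem]

theorem approx_succ_subset (s : ℕ) : approx P (s + 1) ⊆ approx P s := by
  unfold approx
  rw [stage]
  split_ifs
  · refine models_homogenize_subset.trans ?_
    rw [models_andCode]; exact Set.inter_subset_left
  · rw [models_andCode]; exact Set.inter_subset_left

theorem approx_antitone : Antitone (approx P) := antitone_nat_of_succ_le approx_succ_subset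

theorem mem_limitSet_iff {s t : ℕ} (hts : t < s) {X : Set ℕ} (hX : X ∈ approx P s) :
    t ∈ X ↔ t ∈ limitSet P := by
  have hX' : X ∈ approx P (t + 1) := approx_antitone hts hX
  exact ⟨fun h Y hY => (isStage_stage (t + 1)).decided X hX' Y hY t (by omega) h,
    fun h => h X hX'⟩

theorem mem_limitSet_iff_nonempty {s : ℕ} : s ∈ limitSet P ↔
    (Models P (andCode (stage P s).2 (encode (numMem s : MSO n)))).Nonempty := by
  obtain ⟨X, hX⟩ := (isStage_stage (P := P) (s + 1)).nonempty
  rw [← mem_limitSet_iff (Nat.lt_succ_self s) hX]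
  rw [stage] at hX
  split_ifs at hX with h <;> dsimp only at hX
  · have := models_homogenize_subset hX
    rw [models_andCode, models_numMem] at this
    exact iff_of_true this.2 h
  · rw [models_andCode] at hX
    exact iff_of_false (mem_models_not_numMem.1 hX.2) h

theorem limitSet_infinite : (limitSet P).Infinite := by
  rw [Set.infinite_iff_exists_gt]
  intro t
  by_contra! hcon
  obtain ⟨X, hX⟩ := (isStage_stage (P := P) (t + 1)).nonempty
  have hnot : ∀ s, t < s → X ∈ approx P s → s ∉ X := fun s hs hXs hsX => by
    have : s ∈ limitSet P := by
      rw [mem_limitSet_iff_nonempty, models_andCode, models_numMem]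
      exact ⟨X, hXs, hsX⟩
    exact absurd (hcon s this) (by omega)
  have hmem : ∀ s, t + 1 ≤ s → X ∈ approx P s := by
    intro s hs
    induction s, hs using Nat.le_induction with
    | base => exact hX
    | succ s hs ih =>
      have hs' : s ∉ limitSet P := fun h => absurd (hcon s h) (by omega)
      rw [mem_limitSet_iff_nonempty] at hs'
      rw [approx, stage, if_neg hs', models_andCode]
      exact ⟨ih, mem_models_not_numMem.2 (hnot s hs ih)⟩
  obtain ⟨x, hx, htx⟩ := ((isStage_stage (t + 1)).infinite X hX).exists_gt t
  exact hnot x htx (hmem x htx) hx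

theorem limitSet_mem_approx (s : ℕ) : limitSet P ∈ approx P s := by
  refine (isStage_stage s).closed _ limitSet_infinite fun t => ?_
  obtain ⟨X, hX⟩ := (isStage_stage (P := P) (max s t)).nonempty
  exact ⟨X, approx_antitone (le_max_left s t) hX,
    fun u hu => mem_limitSet_iff (lt_max_of_lt_right hu) hX⟩

open Classical in
theorem stage_fst (s : ℕ) : (stage P s).1 = Nat.count (· ∈ limitSet P) s := by
  induction s with
  | zero => simp [stage]
  | succ s ih =>
    rw [Nat.count_succ, stage]
    simp only [mem_limitSet_iff_nonempty]
    split_ifs with h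
    · simp only [ih, mem_limitSet_iff_nonempty]
    · simp only [ih, mem_limitSet_iff_nonempty, add_zero]

theorem pairRel_not {χ : MSO n} (h : fv2 χ = ∅) {x y : ℕ} :
    PairRel P (not χ) x y ↔ ¬ PairRel P χ x y := by
  unfold PairRel
  simp only [Sat]
  have key : ∀ S, Sat (fun x y : ℕ => x < y) P
      (Function.update (Function.update (fun _ => 0) 0 x) 1 y)
      (Function.update (fun _ => ∅) 0 S) χ ↔ Sat (fun x y : ℕ => x < y) P
      (Function.update (Function.update (fun _ => 0) 0 x) 1 y) (fun _ => ∅) χ :=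
    fun S => sat_congr (fun _ _ => rfl) (by simp [h])
  simp only [key, exists_const]

theorem homogenize_homogeneous {s c : ℕ} (hc : IsStage P (s + 1) c) {χ : MSO n}
    (h₁ : fv1 χ ⊆ {0, 1}) (h₂ : fv2 χ = ∅) :
    (∀ X ∈ Models P (homogenize P s (encode χ) c),
      ∀ x ∈ X, ∀ y ∈ X, x < y → s < x → ¬ PairRel P χ x y) ∨
    (∀ X ∈ Models P (homogenize P s (encode χ) c),
      ∀ x ∈ X, ∀ y ∈ X, x < y → s < x → PairRel P χ x y) := by
  have h₂' : fv2 χ ⊆ {0} := by simp [h₂]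
  have hpos : ∀ X, X ∈ Models P (avoidCode n s (encode χ)) ↔
      ∀ x ∈ X, ∀ y ∈ X, x < y → s < x → ¬ PairRel P χ x y := by
    intro X
    rw [mem_models_avoidCode]
    constructor
    · rintro ⟨χ', he, -, -, h⟩
      rwa [← encode_injective he]
    · exact fun h => ⟨χ, rfl, h₁, h₂', h⟩
  have hneg : ∀ X, X ∈ Models P (avoidCode n s (Nat.pair 3 (encode χ))) ↔
      ∀ x ∈ X, ∀ y ∈ X, x < y → s < x → PairRel P χ x y := by
    intro X
    rw [mem_models_avoidCode]
    constructor
    · rintro ⟨χ', he, -, -, h⟩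
      obtain ⟨ψ, rfl, he'⟩ := encode_eq_not he
      obtain rfl := encode_injective he'
      simpa only [pairRel_not h₂, not_not] using h
    · exact fun h => ⟨not χ, rfl, h₁, h₂', by simpa only [pairRel_not h₂, not_not] using h⟩
  unfold homogenize
  split_ifs with hp hn
  · left
    intro X hX
    rw [models_andCode] at hX
    exact (hpos X).1 hX.2
  · right
    intro X hX
    rw [models_andCode] at hX
    exact (hneg X).1 hX.2
  · exfalso
    obtain ⟨X, hX⟩ := hc.nonempty
    obtain ⟨H, hHX, hH, hhom⟩ := exists_infinite_homogeneous (PairRel P χ)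
      ((hc.infinite X hX).sdiff (Set.finite_Iic s))
    set Y : Set ℕ := (X ∩ Set.Iic s) ∪ H with hYdef
    have hYc : Y ∈ Models P c := by
      refine hc.thin X hX Y ?_ (hH.mono Set.subset_union_right) fun t ht htX =>
        .inl ⟨htX, Nat.lt_succ_iff.1 ht⟩
      rintro x (hx | hx)
      · exact hx.1
      · exact (hHX hx).1
    have hYH : ∀ x ∈ Y, s < x → x ∈ H := by
      rintro x (hx | hx) hs
      · exact absurd hx.2 (not_le.2 hs)
      · exact hx
    rw [models_andCode] at hp hn
    rcases hhom with hhom | hhom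
    · exact hn ⟨Y, hYc, (hneg Y).2 fun x hx y hy hxy hs =>
        hhom x (hYH x hx hs) y (hYH y hy (hs.trans hxy)) hxy⟩
    · exact hp ⟨Y, hYc, (hpos Y).2 fun x hx y hy hxy hs =>
        hhom x (hYH x hx hs) y (hYH y hy (hs.trans hxy)) hxy⟩

/-- Every formula in the variables `x₀` and `x₁` has, from some stage on, a constant truth value
on the increasing pairs of large elements of the sets satisfying the constraints. -/
theorem exists_stage_homogeneous {χ : MSO n} (h₁ : fv1 χ ⊆ {0, 1}) (h₂ : fv2 χ = ∅) :
    ∃ s, ∀ X ∈ approx P s, ∀ X' ∈ approx P s, ∀ x ∈ X, ∀ y ∈ X, ∀ x' ∈ X', ∀ y' ∈ X',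
      x < y → x' < y' → s ≤ x → s ≤ x' → (PairRel P χ x y ↔ PairRel P χ x' y') := by
  classical
  set s := Nat.nth (· ∈ limitSet P) (encode χ)
  have hs : s ∈ limitSet P := Nat.nth_mem_of_infinite limitSet_infinite _
  have hk : (stage P s).1 = encode χ := by
    rw [stage_fst, Nat.count_nth_of_infinite (p := (· ∈ limitSet P)) limitSet_infinite]
  have hne := mem_limitSet_iff_nonempty.1 hs
  have hst : (stage P (s + 1)).2 = homogenize P s (encode χ)
      (andCode (stage P s).2 (encode (numMem s : MSO n))) := by
    rw [stage, if_pos hne, hk]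
  have hc := (isStage_stage s).succ_of_decided (b := True) (by simp [models_numMem]) hne
  have := homogenize_homogeneous hc h₁ h₂
  rw [← hst] at this
  refine ⟨s + 1, fun X hX X' hX' x hx y hy x' hx' y' hy' hxy hxy' hsx hsx' => ?_⟩
  rcases this with h | h
  · exact iff_of_false (h X hX x hx y hy hxy hsx) (h X' hX' x' hx' y' hy' hxy' hsx')
  · exact iff_of_true (h X hX x hx y hy hxy hsx) (h X' hX' x' hx' y' hy' hxy' hsx')

end Paper

namespace Paper
open MSO

variable {n : ℕ}

/-- The finite set of codes for types of rank `k` of words with `n` fixed predicates and `m` set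
parameters. -/
def Ty (n m : ℕ) : ℕ → Type
  | 0 => (Fin m → Fin m → Prop) × (Fin m → Fin m → Prop) × (Fin m → Fin n → Prop)
  | k + 1 => Ty n m k × (Fin m → Set (Ty n m k))

instance Ty.finite (n m k : ℕ) : Finite (Ty n m k) := by
  induction k with
  | zero => unfold Ty; infer_instance
  | succ k ih => unfold Ty; infer_instance

/-- The type of rank `k` of the substructure with domain `B`, with parameters `W i`, `i < m`.
Elements are represented by singletons. -/
def tp (P : Fin n → Set ℕ) (m : ℕ) : (k : ℕ) → Set ℕ → (ℕ → Set ℕ) → Ty n m k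
  | 0, B, W =>
    (fun i j => ∃ x ∈ B, ∃ y ∈ B, x ∈ W i ∧ y ∈ W j ∧ x < y,
      fun i j => ∃ x ∈ B, x ∈ W i ∧ x ∈ W j,
      fun i l => ∃ x ∈ B, x ∈ W i ∧ x ∈ P l)
  | k + 1, B, W =>
    (tp P m k B W, fun i => {t | ∃ S, tp P m k B (Function.update W i S) = t})

variable {P : Fin n → Set ℕ} {m : ℕ}

theorem tp_zero_eq_iff {B : Set ℕ} {W : ℕ → Set ℕ} {t : Ty n m 0} :
    tp P m 0 B W = t ↔
      (∀ i j : Fin m, (∃ x ∈ B, ∃ y ∈ B, x ∈ W i ∧ y ∈ W j ∧ x < y) ↔ t.1 i j) ∧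
      (∀ i j : Fin m, (∃ x ∈ B, x ∈ W i ∧ x ∈ W j) ↔ t.2.1 i j) ∧
      (∀ (i : Fin m) (l : Fin n), (∃ x ∈ B, x ∈ W i ∧ x ∈ P l) ↔ t.2.2 i l) := by
  obtain ⟨t₁, t₂, t₃⟩ := t
  refine Prod.mk_inj.trans (and_congr ?_ (Prod.mk_inj.trans (and_congr ?_ ?_))) <;>
    simp only [funext_iff, eq_iff_iff]

theorem tp_succ_eq_iff {k : ℕ} {B : Set ℕ} {W : ℕ → Set ℕ} {t : Ty n m (k + 1)} :
    tp P m (k + 1) B W = t ↔ tp P m k B W = t.1 ∧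
      ∀ (i : Fin m) (u : Ty n m k), (∃ S, tp P m k B (Function.update W i S) = u) ↔ u ∈ t.2 i := by
  obtain ⟨t₁, t₂⟩ := t
  refine Prod.mk_inj.trans (and_congr Iff.rfl ?_)
  simp only [funext_iff, Set.ext_iff]
  rfl

theorem tp_succ_eq_tp_iff {k : ℕ} {B B' : Set ℕ} {W W' : ℕ → Set ℕ} :
    tp P m (k + 1) B W = tp P m (k + 1) B' W' ↔ tp P m k B W = tp P m k B' W' ∧
      ∀ i : Fin m,
        (∀ S, ∃ S', tp P m k B (Function.update W i S) = tp P m k B' (Function.update W' i S')) ∧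
        (∀ S', ∃ S, tp P m k B (Function.update W i S) =
          tp P m k B' (Function.update W' i S')) := by
  rw [tp_succ_eq_iff]
  refine and_congr Iff.rfl (forall_congr' fun i => ?_)
  constructor
  · intro h
    refine ⟨fun S => ?_, fun S' => (h _).2 ⟨S', rfl⟩⟩
    obtain ⟨S', hS'⟩ := (h _).1 ⟨S, rfl⟩
    exact ⟨S', hS'.symm⟩
  · rintro ⟨h₁, h₂⟩ u
    constructor
    · rintro ⟨S, rfl⟩
      obtain ⟨S', hS'⟩ := h₁ S
      exact ⟨S', hS'.symm⟩
    · rintro ⟨S', rfl⟩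
      exact h₂ S'

theorem tp_zero_eq_of_tp_eq {k : ℕ} {B B' : Set ℕ} {W W' : ℕ → Set ℕ}
    (h : tp P m k B W = tp P m k B' W') : tp P m 0 B W = tp P m 0 B' W' := by
  induction k with
  | zero => exact h
  | succ k ih => exact ih (tp_succ_eq_tp_iff.1 h).1

theorem tp_congr {k : ℕ} {B : Set ℕ} : ∀ {W W' : ℕ → Set ℕ},
    (∀ i < m, ∀ x ∈ B, x ∈ W i ↔ x ∈ W' i) → tp P m k B W = tp P m k B W' := by
  induction k with
  | zero =>
    intro W W' h
    have h' : ∀ i : Fin m, ∀ x ∈ B, x ∈ W i ↔ x ∈ W' i := fun i => h i i.2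
    rw [tp_zero_eq_iff]
    refine ⟨fun i j => ?_, fun i j => ?_, fun i l => ?_⟩
    · exact exists_congr fun x => and_congr_right fun hx => exists_congr fun y =>
        and_congr_right fun hy => by rw [h' i x hx, h' j y hy]
    · exact exists_congr fun x => and_congr_right fun hx => by rw [h' i x hx, h' j x hx]
    · exact exists_congr fun x => and_congr_right fun hx => by rw [h' i x hx]
  | succ k ih =>
    intro W W' h
    have key : ∀ (i : Fin m) S, tp P m k B (Function.update W i S) =
        tp P m k B (Function.update W' i S) := by
      refine fun i S => ih fun j hj x hx => ?_
      by_cases hji : j = i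
      · simp [hji]
      · simpa [hji] using h j hj x hx
    rw [tp_succ_eq_tp_iff]
    exact ⟨ih h, fun i => ⟨fun S => ⟨S, key i S⟩, fun S => ⟨S, key i S⟩⟩⟩

/-- The type of an ordered sum is determined by the types of the summands. -/
theorem tp_univ_eq_of_fibers {β β' : ℕ → ℕ} (hβ : Monotone β) (hβ' : Monotone β') {k : ℕ} :
    ∀ {W W' : ℕ → Set ℕ}, (∀ p, tp P m k {x | β x = p} W = tp P m k {x | β' x = p} W') →
      tp P m k Set.univ W = tp P m k Set.univ W' := by
  induction k with
  | zero =>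
    have aux : ∀ {β β' : ℕ → ℕ}, Monotone β → Monotone β' → ∀ {W W' : ℕ → Set ℕ},
        (∀ p, tp P m 0 {x | β x = p} W = tp P m 0 {x | β' x = p} W') →
        (∀ i j : Fin m, (∃ x ∈ Set.univ, ∃ y ∈ Set.univ, x ∈ W i ∧ y ∈ W j ∧ x < y) →
          ∃ x ∈ Set.univ, ∃ y ∈ Set.univ, x ∈ W' i ∧ y ∈ W' j ∧ x < y) ∧
        (∀ i j : Fin m, (∃ x ∈ Set.univ, x ∈ W i ∧ x ∈ W j) →
          ∃ x ∈ Set.univ, x ∈ W' i ∧ x ∈ W' j) ∧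
        (∀ (i : Fin m) (l : Fin n), (∃ x ∈ Set.univ, x ∈ W i ∧ x ∈ P l) →
          ∃ x ∈ Set.univ, x ∈ W' i ∧ x ∈ P l) := by
      intro β β' hβ hβ' W W' h
      have h' := fun p => tp_zero_eq_iff.1 (h p)
      refine ⟨?_, ?_, ?_⟩
      · rintro i j ⟨x, -, y, -, hx, hy, hxy⟩
        rcases (hβ hxy.le).lt_or_eq with hlt | heq
        · obtain ⟨x', hx'β, hx', -⟩ := ((h' (β x)).2.1 i i).1 ⟨x, rfl, hx, hx⟩
          obtain ⟨y', hy'β, hy', -⟩ := ((h' (β y)).2.1 j j).1 ⟨y, rfl, hy, hy⟩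
          refine ⟨x', trivial, y', trivial, hx', hy', ?_⟩
          by_contra hcon
          have := hβ' (not_lt.1 hcon)
          rw [Set.mem_ofPred_eq] at hx'β hy'β
          omega
        · obtain ⟨x', -, y', -, h₃⟩ := ((h' (β y)).1 i j).1 ⟨x, heq, y, rfl, hx, hy, hxy⟩
          exact ⟨x', trivial, y', trivial, h₃⟩
      · rintro i j ⟨x, -, hx⟩
        obtain ⟨x', -, hx'⟩ := ((h' (β x)).2.1 i j).1 ⟨x, rfl, hx⟩
        exact ⟨x', trivial, hx'⟩
      · rintro i j ⟨x, -, hx⟩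
        obtain ⟨x', -, hx'⟩ := ((h' (β x)).2.2 i j).1 ⟨x, rfl, hx⟩
        exact ⟨x', trivial, hx'⟩
    intro W W' h
    have h₁ := aux hβ hβ' h
    have h₂ := aux hβ' hβ fun p => (h p).symm
    rw [tp_zero_eq_iff]
    exact ⟨fun i j => ⟨h₁.1 i j, h₂.1 i j⟩, fun i j => ⟨h₁.2.1 i j, h₂.2.1 i j⟩,
      fun i j => ⟨h₁.2.2 i j, h₂.2.2 i j⟩⟩
  | succ k ih =>
    intro W W' h
    simp only [tp_succ_eq_tp_iff] at h ⊢
    have glue : ∀ (β : ℕ → ℕ) (W : ℕ → Set ℕ) (i : ℕ) (T : ℕ → Set ℕ) (p : ℕ),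
        tp P m k {x | β x = p} (Function.update W i {x | x ∈ T (β x)}) =
          tp P m k {x | β x = p} (Function.update W i (T p)) := by
      rintro β W i T p
      refine tp_congr fun j _ x hx => ?_
      obtain rfl : β x = p := hx
      by_cases hji : j = i
      · simp [hji]
      · simp [hji]
    refine ⟨ih fun p => (h p).1, fun i => ⟨fun S => ?_, fun S => ?_⟩⟩
    · choose T hT using fun p => ((h p).2 i).1 S
      exact ⟨{x | x ∈ T (β' x)}, ih fun p => by rw [glue, hT]⟩
    · choose T hT using fun p => ((h p).2 i).2 S
      exact ⟨{x | x ∈ T (β x)}, ih fun p => by rw [glue, hT]⟩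

/-- A strict bound for the indices of the variables of a formula, where the first-order variable
`i` has index `2 * i` and the set variable `j` has index `2 * j + 1`. -/
def varBound : MSO n → ℕ
  | .lt i j => max (2 * i + 1) (2 * j + 1)
  | .pred _ i => 2 * i + 1
  | .mem i j => max (2 * i + 1) (2 * j + 2)
  | .not φ => varBound φ
  | .and φ ψ => max (varBound φ) (varBound ψ)
  | .ex1 i φ => max (2 * i + 1) (varBound φ)
  | .ex2 j φ => max (2 * j + 2) (varBound φ)

/-- The parameters `W` represent the assignment `v`, `V`. -/
def Represents (W : ℕ → Set ℕ) (v : ℕ → ℕ) (V : ℕ → Set ℕ) : Prop :=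
  (∀ i, W (2 * i) = {v i}) ∧ ∀ j, W (2 * j + 1) = V j

theorem Represents.update1 {W : ℕ → Set ℕ} {v : ℕ → ℕ} {V : ℕ → Set ℕ} (h : Represents W v V)
    (i a : ℕ) : Represents (Function.update W (2 * i) {a}) (Function.update v i a) V := by
  constructor
  · intro j
    by_cases hji : j = i
    · simp [hji]
    · simp [hji, h.1]
  · intro j
    rw [Function.update_of_ne (by omega), h.2]

theorem Represents.update2 {W : ℕ → Set ℕ} {v : ℕ → ℕ} {V : ℕ → Set ℕ} (h : Represents W v V)
    (i : ℕ) (S : Set ℕ) :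
    Represents (Function.update W (2 * i + 1) S) v (Function.update V i S) := by
  constructor
  · intro j
    rw [Function.update_of_ne (by omega), h.1]
  · intro j
    by_cases hji : j = i
    · simp [hji]
    · simp [hji, h.2]

theorem exists_eq_singleton_of_tp_eq {k : ℕ} {W W' : ℕ → Set ℕ} (i : Fin m) {a : ℕ}
    (hi : W i = {a}) (h : tp P m k Set.univ W = tp P m k Set.univ W') : ∃ a', W' i = {a'} := by
  obtain ⟨h₁, h₂, -⟩ := tp_zero_eq_iff.1 (tp_zero_eq_of_tp_eq h)
  obtain ⟨a', -, ha', -⟩ := (h₂ i i).1 ⟨a, trivial, by simp [hi], by simp [hi]⟩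
  refine ⟨a', Set.eq_singleton_iff_unique_mem.2 ⟨ha', fun b hb => ?_⟩⟩
  have hno : ¬ ∃ x ∈ Set.univ, ∃ y ∈ Set.univ, x ∈ W' i ∧ y ∈ W' i ∧ x < y := by
    refine fun hcon => ?_
    obtain ⟨x, -, y, -, hx, hy, hxy⟩ := (h₁ i i).2 hcon
    simp only [hi, Set.mem_singleton_iff] at hx hy
    omega
  rcases lt_trichotomy a' b with hlt | rfl | hlt
  · exact absurd ⟨a', trivial, b, trivial, ha', hb, hlt⟩ hno
  · rfl
  · exact absurd ⟨b, trivial, a', trivial, hb, ha', hlt⟩ hno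

/-- Structures of the same type satisfy the same formulas. -/
theorem sat_iff_of_tp_eq {φ : MSO n} : ∀ {k : ℕ} {W W' : ℕ → Set ℕ} {v v' : ℕ → ℕ}
    {V V' : ℕ → Set ℕ}, qd φ ≤ k → varBound φ ≤ m → Represents W v V → Represents W' v' V' →
    tp P m k Set.univ W = tp P m k Set.univ W' →
    (Sat (fun x y : ℕ => x < y) P v V φ ↔ Sat (fun x y : ℕ => x < y) P v' V' φ) := by
  induction φ with
  | lt i j =>
    intro k W W' v v' V V' _ hm hW hW' h
    simp only [varBound, max_le_iff] at hm
    have := (tp_zero_eq_iff.1 (tp_zero_eq_of_tp_eq h)).1 ⟨2 * i, by omega⟩ ⟨2 * j, by omega⟩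
    simpa [tp, hW.1, hW'.1, Sat] using this
  | pred l i =>
    intro k W W' v v' V V' _ hm hW hW' h
    simp only [varBound] at hm
    have := (tp_zero_eq_iff.1 (tp_zero_eq_of_tp_eq h)).2.2 ⟨2 * i, by omega⟩ l
    simpa [tp, hW.1, hW'.1, Sat] using this
  | mem i j =>
    intro k W W' v v' V V' _ hm hW hW' h
    simp only [varBound, max_le_iff] at hm
    have := (tp_zero_eq_iff.1 (tp_zero_eq_of_tp_eq h)).2.1 ⟨2 * i, by omega⟩ ⟨2 * j + 1, by omega⟩
    simpa [tp, hW.1, hW'.1, hW.2, hW'.2, Sat] using this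
  | not φ ih =>
    intro k W W' v v' V V' hk hm hW hW' h
    exact not_congr (ih hk hm hW hW' h)
  | and φ ψ ih₁ ih₂ =>
    intro k W W' v v' V V' hk hm hW hW' h
    simp only [varBound, qd, max_le_iff] at hm hk
    exact and_congr (ih₁ hk.1 hm.1 hW hW' h) (ih₂ hk.2 hm.2 hW hW' h)
  | ex1 i φ ih =>
    have aux : ∀ {k : ℕ} {W W' : ℕ → Set ℕ} {v v' : ℕ → ℕ} {V V' : ℕ → Set ℕ},
        qd φ ≤ k → max (2 * i + 1) (varBound φ) ≤ m → Represents W v V → Represents W' v' V' →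
        tp P m (k + 1) Set.univ W = tp P m (k + 1) Set.univ W' →
        Sat (fun x y : ℕ => x < y) P v V (ex1 i φ) →
        Sat (fun x y : ℕ => x < y) P v' V' (ex1 i φ) := by
      rintro k W W' v v' V V' hk hm hW hW' h ⟨a, ha⟩
      rw [max_le_iff] at hm
      obtain ⟨S, hS⟩ := ((tp_succ_eq_tp_iff.1 h).2 ⟨2 * i, by omega⟩).1 {a}
      obtain ⟨a', ha'⟩ := exists_eq_singleton_of_tp_eq ⟨2 * i, by omega⟩
        (Function.update_self _ _ _) hS
      rw [Function.update_self] at ha'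
      subst ha'
      exact ⟨a', (ih hk hm.2 (hW.update1 i a) (hW'.update1 i a') hS).1 ha⟩
    intro k W W' v v' V V' hk hm hW hW' h
    obtain ⟨k, rfl⟩ : ∃ l, k = l + 1 := ⟨k - 1, by simp only [qd] at hk; omega⟩
    have hk' : qd φ ≤ k := Nat.le_of_succ_le_succ hk
    exact ⟨aux hk' hm hW hW' h, aux hk' hm hW' hW h.symm⟩
  | ex2 j φ ih =>
    have aux : ∀ {k : ℕ} {W W' : ℕ → Set ℕ} {v v' : ℕ → ℕ} {V V' : ℕ → Set ℕ},
        qd φ ≤ k → max (2 * j + 2) (varBound φ) ≤ m → Represents W v V → Represents W' v' V' →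
        tp P m (k + 1) Set.univ W = tp P m (k + 1) Set.univ W' →
        Sat (fun x y : ℕ => x < y) P v V (ex2 j φ) →
        Sat (fun x y : ℕ => x < y) P v' V' (ex2 j φ) := by
      rintro k W W' v v' V V' hk hm hW hW' h ⟨S, hSat⟩
      rw [max_le_iff] at hm
      obtain ⟨S', hS⟩ := ((tp_succ_eq_tp_iff.1 h).2 ⟨2 * j + 1, by omega⟩).1 S
      exact ⟨S', (ih hk hm.2 (hW.update2 j S) (hW'.update2 j S') hS).1 hSat⟩
    intro k W W' v v' V V' hk hm hW hW' h
    obtain ⟨k, rfl⟩ : ∃ l, k = l + 1 := ⟨k - 1, by simp only [qd] at hk; omega⟩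
    have hk' : qd φ ≤ k := Nat.le_of_succ_le_succ hk
    exact ⟨aux hk' hm hW hW' h, aux hk' hm hW' hW h.symm⟩

end Paper

namespace Paper
open MSO

variable {n : ℕ}

/-- A relation between the first-order variables `x₀`, `x₁` and the set variables `Xᵢ`, `i < m`,
is expressible by an MSO formula. -/
def Expressible (P : Fin n → Set ℕ) (m : ℕ) (R : (ℕ → ℕ) → (ℕ → Set ℕ) → Prop) : Prop :=
  ∃ φ : MSO n, fv1 φ ⊆ {0, 1} ∧ fv2 φ ⊆ Finset.range m ∧
    ∀ v V, Sat (fun x y : ℕ => x < y) P v V φ ↔ R v V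

namespace Expressible

variable {P : Fin n → Set ℕ} {m : ℕ} {R R' : (ℕ → ℕ) → (ℕ → Set ℕ) → Prop}

protected theorem congr (h : Expressible P m R) (hR : ∀ v V, R v V ↔ R' v V) :
    Expressible P m R' := by
  obtain ⟨φ, h₁, h₂, h₃⟩ := h
  exact ⟨φ, h₁, h₂, fun v V => (h₃ v V).trans (hR v V)⟩

protected theorem true : Expressible P m fun _ _ => True :=
  ⟨.not (.lt 0 0), by simp [fv1], by simp [fv2], by simp [Sat]⟩

protected theorem not (h : Expressible P m R) : Expressible P m fun v V => ¬ R v V := by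
  obtain ⟨φ, h₁, h₂, h₃⟩ := h
  exact ⟨.not φ, h₁, h₂, fun v V => not_congr (h₃ v V)⟩

protected theorem and (h : Expressible P m R) (h' : Expressible P m R') :
    Expressible P m fun v V => R v V ∧ R' v V := by
  obtain ⟨φ, h₁, h₂, h₃⟩ := h
  obtain ⟨φ', h₁', h₂', h₃'⟩ := h'
  exact ⟨.and φ φ', Finset.union_subset h₁ h₁', Finset.union_subset h₂ h₂',
    fun v V => and_congr (h₃ v V) (h₃' v V)⟩

protected theorem iff_const (h : Expressible P m R) (p : Prop) :
    Expressible P m fun v V => R v V ↔ p := by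
  by_cases hp : p
  · exact h.congr fun v V => by simp [hp]
  · exact h.not.congr fun v V => by simp [hp]

protected theorem forall_finite {ι : Type*} [Finite ι] {R : ι → (ℕ → ℕ) → (ℕ → Set ℕ) → Prop}
    (h : ∀ i, Expressible P m (R i)) : Expressible P m fun v V => ∀ i, R i v V := by
  classical
  have := Fintype.ofFinite ι
  have key : ∀ s : Finset ι, Expressible P m fun v V => ∀ i ∈ s, R i v V := by
    intro s
    induction s using Finset.induction_on with
    | empty => exact Expressible.true.congr fun v V => by simp
    | insert i s _ ih => exact ((h i).and ih).congr fun v V => by simp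
  exact (key Finset.univ).congr fun v V => by simp

protected theorem exists_set (h : Expressible P m R) {i : ℕ} :
    Expressible P m fun v V => ∃ S, R v (Function.update V i S) := by
  obtain ⟨φ, h₁, h₂, h₃⟩ := h
  exact ⟨.ex2 i φ, h₁, Finset.sdiff_subset.trans h₂, fun v V => exists_congr fun S => h₃ _ _⟩

/-- The set parameters of an expressible relation can be quantified away. -/
theorem exists_params (h : Expressible P m R) :
    Expressible P 0 fun v _ => ∃ V, R v V := by
  induction m generalizing R with
  | zero =>
    obtain ⟨φ, h₁, h₂, h₃⟩ := h
    refine ⟨φ, h₁, h₂, fun v V => ⟨fun hs => ⟨V, (h₃ v V).1 hs⟩, fun ⟨V', hV'⟩ => ?_⟩⟩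
    refine (sat_congr (fun _ _ => rfl) fun j hj => ?_).1 ((h₃ v V').2 hV')
    simpa using h₂ hj
  | succ m ih =>
    have h' : Expressible P m fun v V => ∃ S, R v (Function.update V m S) := by
      obtain ⟨φ, h₁, h₂, h₃⟩ := h
      refine ⟨.ex2 m φ, h₁, fun j hj => ?_, fun v V => exists_congr fun S => h₃ _ _⟩
      simp only [fv2, Finset.mem_sdiff, Finset.mem_singleton] at hj
      have := Finset.mem_range.1 (h₂ hj.1)
      exact Finset.mem_range.2 (by omega)
    refine (ih h').congr fun v V => ⟨fun ⟨V', S, hS⟩ => ⟨_, hS⟩, fun ⟨V', hV'⟩ => ⟨V', V' m, ?_⟩⟩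
    rwa [Function.update_eq_self]

theorem exists_mem_Ico_lt {i j : ℕ} (hi : i < m) (hj : j < m) :
    Expressible P m fun v V => ∃ x ∈ Set.Ico (v 0) (v 1), ∃ y ∈ Set.Ico (v 0) (v 1),
      x ∈ V i ∧ y ∈ V j ∧ x < y := by
  refine ⟨.ex1 2 (.and (.and (.not (.lt 2 0)) (.lt 2 1)) (.ex1 3
    (.and (.and (.not (.lt 3 0)) (.lt 3 1)) (.and (.mem 2 i) (.and (.mem 3 j) (.lt 2 3)))))),
    ?_, ?_, fun v V => by simp [Sat]⟩
  · intro l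
    simp only [fv1, Finset.mem_sdiff, Finset.mem_union, Finset.mem_insert, Finset.mem_singleton]
    omega
  · intro l
    simp only [fv2, Finset.mem_union, Finset.mem_singleton, Finset.mem_range, Finset.notMem_empty,
      false_or, or_false]
    omega

theorem exists_mem_Ico_mem {i j : ℕ} (hi : i < m) (hj : j < m) :
    Expressible P m fun v V => ∃ x ∈ Set.Ico (v 0) (v 1), x ∈ V i ∧ x ∈ V j := by
  refine ⟨.ex1 2 (.and (.and (.not (.lt 2 0)) (.lt 2 1)) (.and (.mem 2 i) (.mem 2 j))),
    ?_, ?_, fun v V => by simp [Sat]⟩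
  · intro l
    simp only [fv1, Finset.mem_sdiff, Finset.mem_union, Finset.mem_insert, Finset.mem_singleton]
    omega
  · intro l
    simp only [fv2, Finset.mem_union, Finset.mem_singleton, Finset.mem_range, Finset.notMem_empty,
      false_or, or_false]
    omega

theorem exists_mem_Ico_pred {i : ℕ} (hi : i < m) (k : Fin n) :
    Expressible P m fun v V => ∃ x ∈ Set.Ico (v 0) (v 1), x ∈ V i ∧ x ∈ P k := by
  refine ⟨.ex1 2 (.and (.and (.not (.lt 2 0)) (.lt 2 1)) (.and (.mem 2 i) (.pred k 2))),
    ?_, ?_, fun v V => by simp [Sat]⟩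
  · intro l
    simp only [fv1, Finset.mem_sdiff, Finset.mem_union, Finset.mem_insert, Finset.mem_singleton]
    omega
  · intro l
    simp only [fv2, Finset.mem_union, Finset.mem_singleton, Finset.mem_range, Finset.notMem_empty,
      false_or, or_false]
    omega

theorem mem_iff_eq {i : ℕ} (hi : i < m) :
    Expressible P m fun v V => v 0 ∈ V i ∧ ¬ ∃ x, v 0 < x ∧ x < v 1 ∧ x ∈ V i := by
  refine ⟨.and (.mem 0 i) (.not (.ex1 2 (.and (.lt 0 2) (.and (.lt 2 1) (.mem 2 i))))),
    ?_, ?_, fun v V => by simp [Sat]⟩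
  · intro l
    simp only [fv1, Finset.mem_sdiff, Finset.mem_union, Finset.mem_insert, Finset.mem_singleton]
    omega
  · intro l
    simp only [fv2, Finset.mem_union, Finset.mem_singleton, Finset.mem_range, Finset.notMem_empty,
      false_or]
    omega

/-- Types of intervals are expressible. -/
theorem tp_Ico_eq {k : ℕ} (t : Ty n m k) :
    Expressible P m fun v V => tp P m k (Set.Ico (v 0) (v 1)) V = t := by
  induction k with
  | zero =>
    refine Expressible.congr ?_ fun v V => tp_zero_eq_iff.symm
    exact .and (.forall_finite fun i => .forall_finite fun j =>
        (exists_mem_Ico_lt i.2 j.2).iff_const _)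
      (.and (.forall_finite fun i => .forall_finite fun j =>
          (exists_mem_Ico_mem i.2 j.2).iff_const _)
        (.forall_finite fun i => .forall_finite fun l => (exists_mem_Ico_pred i.2 l).iff_const _))
  | succ k ih =>
    refine Expressible.congr ?_ fun v V => tp_succ_eq_iff.symm
    exact (ih _).and (.forall_finite fun i => .forall_finite fun u => (ih u).exists_set.iff_const _)

end Expressible

variable {P : Fin n → Set ℕ} {m : ℕ}

/-- The type of the interval `[x, y)` with odd parameters `{x}` and even parameters `∅`. -/
def intervalTp (P : Fin n → Set ℕ) (m k x y : ℕ) : Ty n m k :=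
  tp P m k (Set.Ico x y) fun j => {z | j % 2 = 1 ∧ z = x}

theorem exists_pairRel_intervalTp {k : ℕ} (t : Ty n m k) :
    ∃ χ : MSO n, fv1 χ ⊆ {0, 1} ∧ fv2 χ = ∅ ∧
      ∀ x y, x < y → (PairRel P χ x y ↔ intervalTp P m k x y = t) := by
  have hpar : Expressible P m fun v V => ∀ j : Fin m,
      (j.1 % 2 = 1 → v 0 ∈ V j ∧ ¬ ∃ x, v 0 < x ∧ x < v 1 ∧ x ∈ V j) ∧
      (¬ j.1 % 2 = 1 → ¬ ∃ x ∈ Set.Ico (v 0) (v 1), x ∈ V j ∧ x ∈ V j) := by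
    refine .forall_finite fun j => ?_
    by_cases hj : j.1 % 2 = 1
    · exact (Expressible.mem_iff_eq j.2).congr fun v V => by simp [hj]
    · exact (Expressible.exists_mem_Ico_mem j.2 j.2).not.congr fun v V => by simp [hj]
  obtain ⟨χ, h₁, h₂, h₃⟩ := ((Expressible.tp_Ico_eq (P := P) t).and hpar).exists_params
  refine ⟨χ, h₁, by simpa using h₂, fun x y hxy => ?_⟩
  simp only [PairRel, Sat, h₃, exists_const, ne_eq, zero_ne_one, not_false_eq_true,
    Function.update_of_ne, Function.update_self]
  constructor
  · rintro ⟨V, rfl, hV⟩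
    refine tp_congr fun j hj z hz => ?_
    have hj' := hV ⟨j, hj⟩
    by_cases hodd : j % 2 = 1
    · obtain ⟨h₄, h₅⟩ := hj'.1 hodd
      simp only [hodd, Set.mem_ofPred_eq, true_and]
      constructor
      · rintro rfl
        exact h₄
      · intro hzV
        by_contra hne
        exact h₅ ⟨z, lt_of_le_of_ne hz.1 (Ne.symm hne), hz.2, hzV⟩
    · simp only [hodd, Set.mem_ofPred_eq, false_and, false_iff]
      exact fun hzV => hj'.2 hodd ⟨z, hz, hzV, hzV⟩
  · intro h
    refine ⟨_, h, fun j => ⟨fun hj => ⟨⟨hj, rfl⟩, ?_⟩, fun hj => ?_⟩⟩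
    · rintro ⟨z, hz, -, -, rfl⟩
      exact lt_irrefl _ hz
    · rintro ⟨z, -, hz, -⟩
      exact hj hz.1

theorem exists_stage_intervalTp (P : Fin n → Set ℕ) (m k : ℕ) :
    ∃ s, ∀ X ∈ approx P s, ∀ X' ∈ approx P s, ∀ x ∈ X, ∀ y ∈ X, ∀ x' ∈ X', ∀ y' ∈ X',
      x < y → x' < y' → s ≤ x → s ≤ x' → intervalTp P m k x y = intervalTp P m k x' y' := by
  choose χ h₁ h₂ h₃ using fun t : Ty n m k => exists_pairRel_intervalTp (P := P) t
  choose f hf using fun t => exists_stage_homogeneous (P := P) (h₁ t) (h₂ t)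
  have := Fintype.ofFinite (Ty n m k)
  refine ⟨Finset.univ.sup f, fun X hX X' hX' x hx y hy x' hx' y' hy' hxy hxy' hs hs' => ?_⟩
  have hle : f (intervalTp P m k x y) ≤ Finset.univ.sup f := Finset.le_sup (Finset.mem_univ _)
  have := hf _ X (approx_antitone hle hX) X' (approx_antitone hle hX') x hx y hy x' hx' y' hy'
    hxy hxy' (hle.trans hs) (hle.trans hs')
  rw [h₃ _ _ _ hxy, h₃ _ _ _ hxy'] at this
  exact (this.1 rfl).symm

theorem count_succ_eq_succ_iff {p : ℕ → Prop} [DecidablePred p] (hp : (Set.ofPred p).Infinite)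
    {x i : ℕ} :
    Nat.count p (x + 1) = i + 1 ↔ x ∈ Set.Ico (Nat.nth p i) (Nat.nth p (i + 1)) := by
  have h₁ := Nat.lt_nth_iff_count_lt hp (a := i) (b := x + 1)
  have h₂ := Nat.lt_nth_iff_count_lt hp (a := i + 1) (b := x + 1)
  rw [Set.mem_Ico]
  omega

open Classical in
/-- The truth value of a formula at the limit is already decided at a finite stage. -/
theorem exists_stage_decides {c : ℕ} (hc : IsSetCode n c) :
    ∃ s, approx P s ⊆ Models P c ∨ ∀ X ∈ approx P s, X ∉ Models P c := by
  obtain ⟨θ, rfl, h₁, h₂⟩ := hc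
  obtain ⟨s, hs⟩ := exists_stage_intervalTp P (varBound θ) (qd θ)
  obtain ⟨q, hq, hsq⟩ := Set.infinite_iff_exists_gt.1 (limitSet_infinite (P := P)) s
  suffices h : ∀ X ∈ approx P (q + 1), ∀ X' ∈ approx P (q + 1),
      X ∈ Models P (encode θ) → X' ∈ Models P (encode θ) by
    refine ⟨q + 1, ?_⟩
    by_contra! hcon
    obtain ⟨⟨X, hX, hXθ⟩, X', hX', hX'θ⟩ := Set.not_subset.1 hcon.1, hcon.2
    exact hXθ (h X' hX' X hX hX'θ)
  intro X hX X' hX'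
  let p : Set ℕ → ℕ → Prop := fun Y z => z ∈ Y ∧ q ≤ z
  have hp : ∀ Y ∈ approx P (q + 1), (Set.ofPred (p Y)).Infinite := by
    intro Y hY
    refine Set.infinite_iff_exists_gt.2 fun t => ?_
    obtain ⟨z, hz, htz⟩ := Set.infinite_iff_exists_gt.1
      ((isStage_stage (P := P) (q + 1)).infinite Y hY) (max t q)
    exact ⟨z, ⟨hz, by omega⟩, by omega⟩
  let W : Set ℕ → ℕ → Set ℕ := fun Y j => if j % 2 = 1 then Y else {0}
  have hW : ∀ Y, Represents (W Y) (fun _ => 0) (fun _ => Y) := by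
    intro Y
    exact ⟨fun i => if_neg (by omega), fun i => if_pos (by omega)⟩
  have hmono : ∀ Y, Monotone fun x => Nat.count (p Y) (x + 1) :=
    fun Y x y hxy => Nat.count_monotone _ (by omega)
  have hfib : ∀ Y ∈ approx P (q + 1), {x | Nat.count (p Y) (x + 1) = 0} = Set.Iio q := by
    intro Y hY
    ext x
    have hqY : q ∈ Y := (mem_limitSet_iff (Nat.lt_succ_self q) hY).2 hq
    rw [Set.mem_ofPred_eq, Nat.count_iff_forall_not, Set.mem_Iio]
    constructor
    · intro h
      by_contra hx
      exact h q (by omega) ⟨hqY, le_rfl⟩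
    · intro hx z hz hpz
      have := hpz.2
      omega
  have hint : ∀ Y ∈ approx P (q + 1), ∀ i,
      tp P (varBound θ) (qd θ) {x | Nat.count (p Y) (x + 1) = i + 1} (W Y) =
        intervalTp P (varBound θ) (qd θ) (Nat.nth (p Y) i) (Nat.nth (p Y) (i + 1)) := by
    intro Y hY i
    have hset : {x | Nat.count (p Y) (x + 1) = i + 1} =
        Set.Ico (Nat.nth (p Y) i) (Nat.nth (p Y) (i + 1)) := by
      ext x
      exact count_succ_eq_succ_iff (hp Y hY)
    rw [hset]
    have hmem := Nat.nth_mem_of_infinite (hp Y hY) i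
    refine tp_congr fun j hj x hx => ?_
    have hx₁ := hx.1
    have hqi := hmem.2
    simp only [W, Set.mem_ofPred_eq]
    split_ifs with hodd
    · simp only [hodd, true_and]
      constructor
      · intro hxY
        have hpx : p Y x := ⟨hxY, by omega⟩
        have hcount := (count_succ_eq_succ_iff (hp Y hY)).2 hx
        rw [Nat.count_succ, if_pos hpx] at hcount
        rw [← Nat.nth_count hpx, Nat.succ_injective hcount]
      · rintro rfl
        exact hmem.1
    · simp only [hodd, false_and, iff_false, Set.mem_singleton_iff]
      omega
  have hmem : ∀ Y ∈ approx P (q + 1), ∀ i, p Y (Nat.nth (p Y) i) :=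
    fun Y hY i => Nat.nth_mem_of_infinite (hp Y hY) i
  have hlt : ∀ Y ∈ approx P (q + 1), ∀ i, Nat.nth (p Y) i < Nat.nth (p Y) (i + 1) :=
    fun Y hY i => Nat.nth_strictMono (hp Y hY) (Nat.lt_succ_self i)
  have htp : tp P (varBound θ) (qd θ) Set.univ (W X) =
      tp P (varBound θ) (qd θ) Set.univ (W X') := by
    refine tp_univ_eq_of_fibers (hmono X) (hmono X') fun i => ?_
    cases i with
    | zero =>
      rw [hfib X hX, hfib X' hX']
      refine tp_congr fun j _ x hx => ?_
      rw [Set.mem_Iio] at hx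
      simp only [W]
      split_ifs
      · rw [mem_limitSet_iff (by omega) hX, mem_limitSet_iff (by omega) hX']
      · rfl
    | succ i =>
      rw [hint X hX, hint X' hX']
      have hsub : s ≤ q + 1 := by omega
      have ha := (hmem X hX i).2
      have hb := (hmem X' hX' i).2
      exact hs X (approx_antitone hsub hX) X' (approx_antitone hsub hX')
        _ (hmem X hX i).1 _ (hmem X hX (i + 1)).1 _ (hmem X' hX' i).1 _ (hmem X' hX' (i + 1)).1
        (hlt X hX i) (hlt X' hX' i) (by omega) (by omega)
  rw [mem_models_encode h₁ h₂, mem_models_encode h₁ h₂]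
  exact (sat_iff_of_tp_eq le_rfl le_rfl (hW X) (hW X') htp).1

theorem not_definable_limitSet :
    ¬ Definable (fun x y : ℕ => x < y) P (limitSet P) := by
  rintro ⟨δ, h₁, h₂, hδ⟩
  have hsat : ∀ v V, Sat (fun x y : ℕ => x < y) P v V δ ↔ v 0 ∈ limitSet P := by
    intro v V
    rw [hδ]
    constructor
    · intro h v' V'
      refine (sat_congr (fun i hi => ?_) (by simp [h₂])).1 h
      obtain rfl : i = 0 := by simpa using h₁ hi
      simp
    · intro h
      simpa using h v V
  let χ : MSO n := ex1 2 (and (and (lt 0 2) (lt 2 1))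
    (ex1 0 (and (and (.not (lt 0 2)) (.not (lt 2 0))) δ)))
  have hχ : ∀ x y, PairRel P χ x y ↔ ∃ z ∈ limitSet P, x < z ∧ z < y := by
    intro x y
    simp only [PairRel, χ, Sat, hsat]
    simp only [exists_const, Function.update_self, ne_eq, Function.update_of_ne,
      OfNat.ofNat_ne_zero, OfNat.zero_ne_ofNat, OfNat.one_ne_ofNat,
      not_false_eq_true, zero_ne_one, not_lt]
    constructor
    · rintro ⟨z, hz, w, hw, hwQ⟩
      obtain rfl : w = z := by omega
      exact ⟨w, hwQ, hz⟩
    · rintro ⟨z, hzQ, hz⟩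
      exact ⟨z, hz, z, ⟨le_rfl, le_rfl⟩, hzQ⟩
  have hf₁ : fv1 χ ⊆ {0, 1} := by
    intro i hi
    have := @h₁ i
    simp only [χ, fv1, Finset.mem_sdiff, Finset.mem_union, Finset.mem_insert,
      Finset.mem_singleton] at hi this ⊢
    tauto
  have hf₂ : fv2 χ = ∅ := by simp [χ, fv2, h₂]
  obtain ⟨s, hs⟩ := exists_stage_homogeneous (P := P) hf₁ hf₂
  obtain ⟨a, ha, hsa⟩ := Set.infinite_iff_exists_gt.1 (limitSet_infinite (P := P)) s
  have hex : ∃ b, b ∈ limitSet P ∧ a < b :=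
    Set.infinite_iff_exists_gt.1 (limitSet_infinite (P := P)) a
  classical
  obtain ⟨hb, hab⟩ := Nat.find_spec hex
  have hmin := fun z => Nat.find_min hex (m := z)
  generalize Nat.find hex = b at hb hab hmin
  obtain ⟨c, hc, hbc⟩ := Set.infinite_iff_exists_gt.1 (limitSet_infinite (P := P)) b
  have hQ := limitSet_mem_approx (P := P) s
  have := hs _ hQ _ hQ a ha b hb a ha c hc hab (hab.trans hbc) hsa.le hsa.le
  rw [hχ, hχ] at this
  obtain ⟨z, hz, haz, hzb⟩ := this.2 ⟨b, hb, hab, hbc⟩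
  exact hmin z hzb ⟨hz, haz⟩

end Paper

namespace Paper
open MSO

variable {n : ℕ}

/-- Replace the last predicate by the set variable `X₀`, shifting the other set variables. -/
def MSO.lastToVar : MSO (n + 1) → MSO n
  | .lt i j => .lt i j
  | .pred k i => if h : k.1 < n then .pred ⟨k, h⟩ i else .mem i 0
  | .mem i j => .mem i (j + 1)
  | .not φ => .not (lastToVar φ)
  | .and φ ψ => .and (lastToVar φ) (lastToVar ψ)
  | .ex1 i φ => .ex1 i (lastToVar φ)
  | .ex2 j φ => .ex2 (j + 1) (lastToVar φ)

/-- The assignment sending `X₀` to `Q` and `Xⱼ₊₁` to `V j`. -/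
def consSet (Q : Set ℕ) (V : ℕ → Set ℕ) : ℕ → Set ℕ
  | 0 => Q
  | j + 1 => V j

theorem consSet_update (Q : Set ℕ) (V : ℕ → Set ℕ) (j : ℕ) (S : Set ℕ) :
    consSet Q (Function.update V j S) = Function.update (consSet Q V) (j + 1) S := by
  funext i
  cases i with
  | zero => simp [consSet]
  | succ i => by_cases h : i = j <;> simp [consSet, h]

theorem sat_lastToVar {P : Fin n → Set ℕ} {Q : Set ℕ} {φ : MSO (n + 1)} :
    ∀ {v : ℕ → ℕ} {V : ℕ → Set ℕ},
      Sat (fun x y : ℕ => x < y) P v (consSet Q V) (lastToVar φ) ↔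
        Sat (fun x y : ℕ => x < y) (Fin.snoc P Q) v V φ := by
  induction φ with
  | lt i j => exact Iff.rfl
  | pred k i =>
    intro v V
    unfold lastToVar
    by_cases h : k.1 < n
    · simp only [h, dif_pos, Sat, Fin.snoc, cast_eq]
      rfl
    · simp only [h, dif_neg, Sat, Fin.snoc, cast_eq, not_false_eq_true]
      rfl
  | mem i j => exact Iff.rfl
  | not φ ih => exact not_congr ih
  | and φ ψ ih₁ ih₂ => exact and_congr ih₁ ih₂
  | ex1 i φ ih => exact exists_congr fun a => ih
  | ex2 j φ ih =>
    intro v V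
    refine exists_congr fun S => ?_
    rw [← consSet_update]
    exact ih

theorem fv1_lastToVar (φ : MSO (n + 1)) : fv1 (lastToVar φ) = fv1 φ := by
  induction φ with
  | pred k i => unfold lastToVar; split_ifs <;> rfl
  | _ => simp_all [lastToVar, fv1]

theorem succ_mem_fv2_lastToVar {φ : MSO (n + 1)} {j : ℕ} :
    j + 1 ∈ fv2 (lastToVar φ) ↔ j ∈ fv2 φ := by
  induction φ with
  | pred k i => unfold lastToVar; split_ifs <;> simp [fv2]
  | _ => simp_all [lastToVar, fv2]

theorem fv2_lastToVar_subset {φ : MSO (n + 1)} : fv2 (lastToVar φ) ⊆ {0} ↔ fv2 φ = ∅ := by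
  simp only [Finset.eq_empty_iff_forall_notMem, ← succ_mem_fv2_lastToVar, Finset.subset_iff,
    Finset.mem_singleton]
  constructor
  · exact fun h j hj => Nat.succ_ne_zero j (h hj)
  · intro h j hj
    cases j with
    | zero => rfl
    | succ j => exact absurd hj (h j)

/-- `MSO.lastToVar` on codes. -/
def lastToVarCode (n c : ℕ) : ℕ :=
  if c.unpair.1 = 1 then
    if c.unpair.2.unpair.1 = n then Nat.pair 2 (Nat.pair c.unpair.2.unpair.2 0) else c
  else if c.unpair.1 = 2 then
    Nat.pair 2 (Nat.pair c.unpair.2.unpair.1 (c.unpair.2.unpair.2 + 1))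
  else if _h₃ : c.unpair.1 = 3 then
    Nat.pair 3 (lastToVarCode n c.unpair.2)
  else if _h₄ : c.unpair.1 = 4 then
    Nat.pair 4 (Nat.pair (lastToVarCode n c.unpair.2.unpair.1)
      (lastToVarCode n c.unpair.2.unpair.2))
  else if _h₅ : c.unpair.1 = 5 then
    Nat.pair 5 (Nat.pair c.unpair.2.unpair.1 (lastToVarCode n c.unpair.2.unpair.2))
  else if _h₆ : c.unpair.1 = 6 then
    Nat.pair 6 (Nat.pair (c.unpair.2.unpair.1 + 1) (lastToVarCode n c.unpair.2.unpair.2))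
  else c
termination_by c
decreasing_by
  all_goals
    have h₁ := Nat.unpair_add_le c
    have h₂ := Nat.unpair_add_le c.unpair.2
    omega

theorem lastToVarCode_encode (φ : MSO (n + 1)) :
    lastToVarCode n (encode φ) = encode (lastToVar φ) := by
  induction φ with
  | pred k i =>
    rw [lastToVarCode]
    have := k.2
    by_cases h : k.1 < n
    · simp [encode, lastToVar, h, h.ne]
    · have h' : k.1 = n := by omega
      simp [encode, lastToVar, h']
  | _ => rw [lastToVarCode]; simp_all [encode, lastToVar]

theorem exists_of_lastToVarCode_eq {c : ℕ} : ∀ {ψ : MSO n}, lastToVarCode n c = encode ψ →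
    ∃ φ : MSO (n + 1), encode φ = c ∧ lastToVar φ = ψ := by
  induction c using Nat.strong_induction_on with
  | _ c ih =>
    intro ψ h
    have hlt : 0 < c.unpair.1 → c.unpair.2 < c := fun hpos => by
      have := Nat.unpair_add_le c
      omega
    have hlt₁ : 0 < c.unpair.1 → c.unpair.2.unpair.1 < c := fun hpos =>
      (Nat.unpair_left_le _).trans_lt (hlt hpos)
    have hlt₂ : 0 < c.unpair.1 → c.unpair.2.unpair.2 < c := fun hpos =>
      (Nat.unpair_right_le _).trans_lt (hlt hpos)
    obtain ⟨t, i, j, rfl⟩ : ∃ t i j, c = Nat.pair t (Nat.pair i j) :=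
      ⟨c.unpair.1, c.unpair.2.unpair.1, c.unpair.2.unpair.2, by simp⟩
    simp only [Nat.unpair_pair] at hlt hlt₁ hlt₂
    rw [lastToVarCode] at h
    simp only [Nat.unpair_pair] at h
    split_ifs at h with h₁ h₂ h₃ h₄ h₅ h₆ h₇
    · subst h₁ h₂
      cases ψ <;> simp only [encode, Nat.pair_eq_pair, OfNat.ofNat_ne_zero, OfNat.ofNat_ne_one,
        false_and, Nat.reduceEqDiff, true_and] at h
      obtain ⟨rfl, rfl⟩ := h
      exact ⟨.pred (Fin.last _) j, by simp [encode], by simp [lastToVar]⟩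
    · subst h₁
      cases ψ <;> simp only [encode, Nat.pair_eq_pair, OfNat.one_ne_ofNat, one_ne_zero,
        false_and, true_and] at h
      obtain ⟨rfl, rfl⟩ := h
      rename_i k
      exact ⟨.pred k.castSucc j, by simp [encode], by simp [lastToVar]⟩
    · subst h₃
      cases ψ <;> simp only [encode, Nat.pair_eq_pair, OfNat.ofNat_ne_zero, OfNat.ofNat_ne_one,
        false_and, Nat.reduceEqDiff, true_and] at h
      obtain ⟨rfl, rfl⟩ := h
      exact ⟨.mem i j, by simp [encode], by simp [lastToVar]⟩
    · subst h₄
      obtain ⟨ψ, rfl, h'⟩ := encode_eq_not h.symm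
      obtain ⟨φ, h₈, rfl⟩ := ih _ (hlt (by omega)) h'.symm
      exact ⟨.not φ, by simp [encode, h₈], rfl⟩
    · subst h₅
      obtain ⟨ψ, ψ', rfl, h', h''⟩ := encode_eq_and h.symm
      obtain ⟨φ, h₈, rfl⟩ := ih _ (hlt₁ (by omega)) h'.symm
      obtain ⟨φ', h₉, rfl⟩ := ih _ (hlt₂ (by omega)) h''.symm
      exact ⟨.and φ φ', by simp [encode, h₈, h₉], rfl⟩
    · subst h₆
      obtain ⟨ψ, rfl, h'⟩ := encode_eq_ex1 h.symm
      obtain ⟨φ, h₈, rfl⟩ := ih _ (hlt₂ (by omega)) h'.symm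
      exact ⟨.ex1 i φ, by simp [encode, h₈], rfl⟩
    · subst h₇
      obtain ⟨ψ, rfl, h'⟩ := encode_eq_ex2 h.symm
      obtain ⟨φ, h₈, rfl⟩ := ih _ (hlt₂ (by omega)) h'.symm
      exact ⟨.ex2 i φ, by simp [encode, h₈], rfl⟩
    · cases ψ <;> simp only [encode, Nat.pair_eq_pair] at h <;> try omega
      obtain ⟨rfl, rfl, rfl⟩ := h
      exact ⟨.lt _ _, rfl, rfl⟩

/-- Truth in the expansion by `Q` reduces to satisfaction by `Q`. -/
theorem mem_theoryCodes_snoc {P : Fin n → Set ℕ} {Q : Set ℕ} {c : ℕ} :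
    c ∈ TheoryCodes (fun x y : ℕ => x < y) (Fin.snoc P Q : Fin (n + 1) → Set ℕ) ↔
      Q ∈ Models P (lastToVarCode n c) := by
  have hcons : consSet Q (fun _ => Q) = fun _ => Q := by
    funext j
    cases j <;> rfl
  constructor
  · rintro ⟨φ, hφ, rfl, ht⟩
    refine ⟨lastToVar φ, (lastToVarCode_encode φ).symm, (fv1_lastToVar φ).trans hφ.1,
      fv2_lastToVar_subset.2 hφ.2, ?_⟩
    rw [← hcons, sat_lastToVar]
    exact ht _ _
  · rintro ⟨ψ, h₁, h₂, h₃, h₄⟩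
    obtain ⟨φ, rfl, rfl⟩ := exists_of_lastToVarCode_eq h₁.symm
    have hφ : IsSentence φ := ⟨(fv1_lastToVar φ).symm.trans h₂, fv2_lastToVar_subset.1 h₃⟩
    refine ⟨φ, hφ, rfl, (trueIn_iff_sat hφ (fun _ => 0) (fun _ => Q)).2 ?_⟩
    rwa [← hcons, sat_lastToVar] at h₄

theorem primrec_lastToVarCode (n : ℕ) : Primrec (lastToVarCode n) := by
  let get : List ℕ → ℕ → ℕ := fun L i => L.getD i 0
  let g : Unit → List ℕ → Option ℕ := fun _ L => some <|
    let c := L.length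
    if c.unpair.1 = 1 then
      if c.unpair.2.unpair.1 = n then Nat.pair 2 (Nat.pair c.unpair.2.unpair.2 0) else c
    else if c.unpair.1 = 2 then
      Nat.pair 2 (Nat.pair c.unpair.2.unpair.1 (c.unpair.2.unpair.2 + 1))
    else if c.unpair.1 = 3 then
      Nat.pair 3 (get L c.unpair.2)
    else if c.unpair.1 = 4 then
      Nat.pair 4 (Nat.pair (get L c.unpair.2.unpair.1) (get L c.unpair.2.unpair.2))
    else if c.unpair.1 = 5 then
      Nat.pair 5 (Nat.pair c.unpair.2.unpair.1 (get L c.unpair.2.unpair.2))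
    else if c.unpair.1 = 6 then
      Nat.pair 6 (Nat.pair (c.unpair.2.unpair.1 + 1) (get L c.unpair.2.unpair.2))
    else c
  have hl : Primrec fun p : Unit × List ℕ => p.2.length := Primrec.list_length.comp Primrec.snd
  have hget : Primrec₂ get := Primrec.list_getD 0
  have h₁ : Primrec fun p : Unit × List ℕ => p.2.length.unpair.1 :=
    Primrec.fst.comp (Primrec.unpair.comp hl)
  have h₂ : Primrec fun p : Unit × List ℕ => p.2.length.unpair.2 :=
    Primrec.snd.comp (Primrec.unpair.comp hl)
  have h₂₁ : Primrec fun p : Unit × List ℕ => p.2.length.unpair.2.unpair.1 :=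
    Primrec.fst.comp (Primrec.unpair.comp h₂)
  have h₂₂ : Primrec fun p : Unit × List ℕ => p.2.length.unpair.2.unpair.2 :=
    Primrec.snd.comp (Primrec.unpair.comp h₂)
  have hc : ∀ i : ℕ, PrimrecPred fun p : Unit × List ℕ => p.2.length.unpair.1 = i :=
    fun i => Primrec.eq.comp h₁ (Primrec.const i)
  have hp : ∀ {f f' : Unit × List ℕ → ℕ}, Primrec f → Primrec f' →
      Primrec fun p => Nat.pair (f p) (f' p) := fun hf hf' => Primrec₂.natPair.comp hf hf'
  have hg : Primrec₂ g := by
    refine Primrec.option_some.comp ?_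
    refine Primrec.ite (hc 1) (Primrec.ite (Primrec.eq.comp h₂₁ (Primrec.const n))
      (hp (Primrec.const 2) (hp h₂₂ (Primrec.const 0))) hl) ?_
    refine Primrec.ite (hc 2) (hp (Primrec.const 2) (hp h₂₁ (Primrec.succ.comp h₂₂))) ?_
    refine Primrec.ite (hc 3) (hp (Primrec.const 3) (hget.comp Primrec.snd h₂)) ?_
    refine Primrec.ite (hc 4) (hp (Primrec.const 4) (hp (hget.comp Primrec.snd h₂₁)
      (hget.comp Primrec.snd h₂₂))) ?_
    refine Primrec.ite (hc 5) (hp (Primrec.const 5) (hp h₂₁ (hget.comp Primrec.snd h₂₂))) ?_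
    exact Primrec.ite (hc 6) (hp (Primrec.const 6) (hp (Primrec.succ.comp h₂₁)
      (hget.comp Primrec.snd h₂₂))) hl
  have key : Primrec₂ fun (_ : Unit) c => lastToVarCode n c := by
    refine Primrec.nat_strong_rec _ hg fun _ c => ?_
    have hget' : ∀ i, i < c →
        get ((List.range c).map fun c => lastToVarCode n c) i = lastToVarCode n i := by
      intro i hi
      simp [get, List.getD_eq_getElem?_getD, hi]
    have hlt : 0 < c.unpair.1 → c.unpair.2 < c := fun hpos => by
      have := Nat.unpair_add_le c
      omega
    have hlt₁ : 0 < c.unpair.1 → c.unpair.2.unpair.1 < c := fun hpos =>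
      (Nat.unpair_left_le _).trans_lt (hlt hpos)
    have hlt₂ : 0 < c.unpair.1 → c.unpair.2.unpair.2 < c := fun hpos =>
      (Nat.unpair_right_le _).trans_lt (hlt hpos)
    rw [lastToVarCode]
    simp only [g, List.length_map, List.length_range, Option.some_inj]
    split_ifs with h₁ h₂ h₃ h₄ h₅ h₆ h₇
    · rfl
    · rfl
    · rfl
    · rw [hget' _ (hlt (by omega))]
    · rw [hget' _ (hlt₁ (by omega)), hget' _ (hlt₂ (by omega))]
    · rw [hget' _ (hlt₂ (by omega))]
    · rw [hget' _ (hlt₂ (by omega))]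
    · rfl
  exact key.comp (Primrec.const ()) Primrec.id

end Paper

namespace Paper
open MSO

theorem RecursiveIn.of_eq {O f g : ℕ →. ℕ} (h : RecursiveIn O f) (hfg : ∀ x, f x = g x) :
    RecursiveIn O g := (funext hfg : f = g) ▸ h

/-- A total function recursive in the oracle `O`. -/
def TotalRecIn (O : ℕ →. ℕ) (f : ℕ → ℕ) : Prop := RecursiveIn O fun x => Part.some (f x)

namespace TotalRecIn

variable {O : ℕ →. ℕ} {f g h : ℕ → ℕ}

protected theorem of_eq (hf : TotalRecIn O f) (hfg : ∀ x, f x = g x) : TotalRecIn O g :=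
  (funext hfg : f = g) ▸ hf

theorem comp (hf : TotalRecIn O f) (hg : TotalRecIn O g) : TotalRecIn O fun x => f (g x) := by
  have := RecursiveIn.comp hf hg
  simpa [TotalRecIn] using this

theorem natPair (hf : TotalRecIn O f) (hg : TotalRecIn O g) :
    TotalRecIn O fun x => Nat.pair (f x) (g x) := by
  have := RecursiveIn.pair hf hg
  simpa [TotalRecIn, Seq.seq] using this

theorem left : TotalRecIn O fun x => x.unpair.1 := RecursiveIn.left

theorem right : TotalRecIn O fun x => x.unpair.2 := RecursiveIn.right

theorem unpaired_rec (hf : TotalRecIn O f) (hg : TotalRecIn O g) :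
    TotalRecIn O (Nat.unpaired fun a m =>
      Nat.rec (f a) (fun y ih => g (Nat.pair a (Nat.pair y ih))) m) := by
  refine (RecursiveIn.prec hf hg).of_eq fun x => ?_
  simp only [Nat.unpaired]
  generalize x.unpair.2 = m
  induction m with
  | zero => rfl
  | succ m ih =>
    simp only at ih ⊢
    rw [ih]
    exact Part.bind_some _ _

theorem of_nat_primrec (hf : Nat.Primrec f) : TotalRecIn O f := by
  induction hf with
  | zero => exact RecursiveIn.zero
  | succ => exact RecursiveIn.succ
  | left => exact left
  | right => exact right
  | pair _ _ h₁ h₂ => exact h₁.natPair h₂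
  | comp _ _ h₁ h₂ => exact h₁.comp h₂
  | prec _ _ h₁ h₂ => exact h₁.unpaired_rec h₂

theorem of_primrec (hf : Primrec f) : TotalRecIn O f := of_nat_primrec (Primrec.nat_iff.1 hf)

theorem const (a : ℕ) : TotalRecIn O fun _ => a := of_primrec (Primrec.const a)

theorem ite_eq_zero (hf : TotalRecIn O f) (hg : TotalRecIn O g) (hh : TotalRecIn O h) :
    TotalRecIn O fun x => if f x = 0 then g x else h x := by
  have key : Primrec fun p : ℕ =>
      if p.unpair.1 = 0 then p.unpair.2.unpair.1 else p.unpair.2.unpair.2 :=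
    Primrec.ite (Primrec.eq.comp (Primrec.fst.comp Primrec.unpair) (Primrec.const 0))
      (Primrec.fst.comp (Primrec.unpair.comp (Primrec.snd.comp Primrec.unpair)))
      (Primrec.snd.comp (Primrec.unpair.comp (Primrec.snd.comp Primrec.unpair)))
  have := (of_primrec (O := O) key).comp (hf.natPair (hg.natPair hh))
  simpa using this

theorem nat_rec (a : ℕ) (hg : TotalRecIn O g) :
    TotalRecIn O fun m => Nat.rec a (fun y ih => g (Nat.pair y ih)) m := by
  have := ((const a).unpaired_rec (hg.comp right)).comp
    ((const 0).natPair (of_primrec (O := O) Primrec.id))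
  simpa [Nat.unpaired] using this

theorem exists_search (hf : TotalRecIn O f) (hex : ∀ a, ∃ m, f (Nat.pair a m) = 0) :
    ∃ g, TotalRecIn O g ∧ ∀ a, f (Nat.pair a (g a)) = 0 := by
  classical
  refine ⟨fun a => Nat.find (hex a), ?_, fun a => Nat.find_spec (hex a)⟩
  refine (RecursiveIn.rfind hf).of_eq fun a => Part.eq_some_iff.2 ?_
  refine Nat.mem_rfind.2 ⟨by simpa using Nat.find_spec (hex a), fun {m} hm => ?_⟩
  simpa using Nat.find_min (hex a) hm

theorem query {T : Set ℕ} (hf : TotalRecIn (chi T) f) :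
    TotalRecIn (chi T) fun x => T.indicator (fun _ => 1) (f x) :=
  comp (f := fun x => T.indicator (fun _ => 1) x) RecursiveIn.oracle hf

end TotalRecIn

theorem RecursiveIn.partrec {O f : ℕ →. ℕ} (hO : Nat.Partrec O) (h : RecursiveIn O f) :
    Nat.Partrec f := by
  induction h with
  | zero => exact .zero
  | succ => exact .succ
  | left => exact .left
  | right => exact .right
  | oracle => exact hO
  | pair _ _ h₁ h₂ => exact .pair h₁ h₂
  | comp _ _ h₁ h₂ => exact .comp h₁ h₂
  | prec _ _ h₁ h₂ => exact .prec h₁ h₂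
  | rfind _ h₁ => exact .rfind h₁

theorem TuringRed.decidableSet {S T : Set ℕ} (h : TuringRed S T) (hT : DecidableSet T) :
    DecidableSet S := by
  classical
  have hchi : Nat.Partrec (chi T) := by
    obtain ⟨_, hT⟩ := hT
    refine Partrec.nat_iff.1 ?_
    have : Computable fun x => cond (decide (x ∈ T)) 1 0 :=
      Computable.cond hT (Computable.const 1) (Computable.const 0)
    refine Partrec.of_eq this fun x => ?_
    by_cases hx : x ∈ T <;> simp [chi, hx]
  have hS : Computable fun x => S.indicator (fun _ => 1) x := Partrec.nat_iff.2 (h.partrec hchi)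
  refine ⟨Classical.decPred _, ?_⟩
  refine ((Primrec.eq.decide.to_comp.comp hS (Computable.const 1))).of_eq fun x => ?_
  by_cases hx : x ∈ S <;> simp [hx]

variable {n : ℕ} {P : Fin n → Set ℕ}

theorem primrec_encode_geNum : Primrec fun s => encode (geNum s : MSO n) := by
  have hp : ∀ (a : ℕ) {f : ℕ × ℕ → ℕ}, Primrec f → Primrec fun p => Nat.pair a (f p) :=
    fun a f hf => Primrec₂.natPair.comp (Primrec.const a) hf
  have hstep : Primrec₂ fun (_ c : ℕ) => Nat.pair 5 (Nat.pair 1 (Nat.pair 4 (Nat.pair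
      (encode (lt 1 0 : MSO n)) (Nat.pair 5 (Nat.pair 0 (Nat.pair 4 (Nat.pair
        (encode (and (.not (lt 0 1)) (.not (lt 1 0)) : MSO n)) c))))))) :=
    hp _ <| hp _ <| hp _ <| hp _ <| hp _ <| hp _ <| hp _ <| hp _ Primrec.snd
  refine (Primrec.nat_rec₁ (encode (geNum 0 : MSO n)) hstep).of_eq fun s => ?_
  induction s with
  | zero => rfl
  | succ s ih =>
    simp only at ih ⊢
    rw [ih]
    rfl

theorem TotalRecIn.numMem {O : ℕ →. ℕ} {f : ℕ → ℕ} (hf : TotalRecIn O f) :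
    TotalRecIn O fun x => encode (numMem (f x) : MSO n) := by
  have h₁ : TotalRecIn O fun x => encode (geNum (f x) : MSO n) :=
    (of_primrec primrec_encode_geNum).comp hf
  have h₂ : TotalRecIn O fun x => encode (geNum (f x + 1) : MSO n) :=
    (of_primrec (primrec_encode_geNum.comp Primrec.succ)).comp hf
  exact (const 5).natPair <| (const 0).natPair <| (const 4).natPair <|
    (const (encode (mem 0 0 : MSO n))).natPair <| (const 4).natPair <|
      h₁.natPair <| (const 3).natPair h₂

theorem TotalRecIn.avoidCode {O : ℕ →. ℕ} {f g : ℕ → ℕ} (hf : TotalRecIn O f)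
    (hg : TotalRecIn O g) : TotalRecIn O fun x => avoidCode n (f x) (g x) := by
  have h₂ : TotalRecIn O fun x => encode (geNum (f x + 1) : MSO n) :=
    (of_primrec (primrec_encode_geNum.comp Primrec.succ)).comp hf
  have h₃ : TotalRecIn O fun x => encode (and (and (mem 0 0) (mem 1 0))
      (and (lt 0 1) (geNum (f x + 1))) : MSO n) :=
    (const 4).natPair <| (const (encode (and (mem 0 0) (mem 1 0) : MSO n))).natPair <|
      (const 4).natPair <| (const (encode (lt 0 1 : MSO n))).natPair h₂
  exact (const 3).natPair <| (const 5).natPair <| (const 0).natPair <| (const 5).natPair <|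
    (const 1).natPair <| (const 4).natPair <| h₃.natPair <| (const 6).natPair <|
      (const 0).natPair hg

theorem TotalRecIn.andCode {O : ℕ →. ℕ} {f g : ℕ → ℕ} (hf : TotalRecIn O f)
    (hg : TotalRecIn O g) : TotalRecIn O fun x => andCode (f x) (g x) :=
  (const 4).natPair (hf.natPair hg)

open Classical in
theorem TotalRecIn.ite_nonempty {f g h : ℕ → ℕ}
    (hf : TotalRecIn (chi (TheoryCodes (fun x y : ℕ => x < y) P)) f)
    (hg : TotalRecIn (chi (TheoryCodes (fun x y : ℕ => x < y) P)) g)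
    (hh : TotalRecIn (chi (TheoryCodes (fun x y : ℕ => x < y) P)) h) :
    TotalRecIn (chi (TheoryCodes (fun x y : ℕ => x < y) P)) fun x =>
      if (Models P (f x)).Nonempty then g x else h x := by
  refine ((query ((const 6).natPair ((const 0).natPair hf))).ite_eq_zero hh hg).of_eq
    fun x => ?_
  simp only [Set.indicator_apply_eq_zero, mem_theory_ex2, one_ne_zero, imp_false, ite_not]

theorem totalRecIn_stage : TotalRecIn (chi (TheoryCodes (fun x y : ℕ => x < y) P)) fun s =>
    Nat.pair (stage P s).1 (stage P s).2 := by
  classical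
  set O := chi (TheoryCodes (fun x y : ℕ => x < y) P)
  have hs : TotalRecIn O fun x => x.unpair.1 := .left
  have hk : TotalRecIn O fun x => x.unpair.2.unpair.1 := TotalRecIn.left.comp .right
  have hc : TotalRecIn O fun x => x.unpair.2.unpair.2 := TotalRecIn.right.comp .right
  have hd := hc.andCode (hs.numMem (n := n))
  have h₁ := hd.andCode (hs.avoidCode (n := n) hk)
  have h₂ := hd.andCode (hs.avoidCode (n := n) ((TotalRecIn.const 3).natPair hk))
  have hstep := hd.ite_nonempty
    (((TotalRecIn.of_primrec Primrec.succ).comp hk).natPair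
      (h₁.ite_nonempty h₁ (h₂.ite_nonempty h₂ hd)))
    (hk.natPair (hc.andCode ((TotalRecIn.const 3).natPair (hs.numMem (n := n)))))
  refine (TotalRecIn.nat_rec (Nat.pair 0 (encode (infin : MSO n))) hstep).of_eq fun s => ?_
  induction s with
  | zero => rfl
  | succ s ih =>
    simp only at ih ⊢
    rw [ih, stage]
    simp only [Nat.unpair_pair, homogenize]
    split_ifs <;> simp only [Nat.succ_eq_add_one]

/-- The code of the sentence stating that all sets satisfying the constraints of stage `s` satisfy
the formula with code `d`. -/
noncomputable def forcesCode (P : Fin n → Set ℕ) (s d : ℕ) : ℕ :=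
  Nat.pair 3 (Nat.pair 6 (Nat.pair 0 (andCode (stage P s).2 (Nat.pair 3 d))))

theorem forcesCode_mem_theory {s d : ℕ} :
    forcesCode P s d ∈ TheoryCodes (fun x y : ℕ => x < y) P ↔
      IsSetCode n d ∧ approx P s ⊆ Models P d := by
  rw [forcesCode, mem_theory_not_ex2, models_andCode, andCode, isSetCode_and, isSetCode_not,
    and_iff_right (isStage_stage s).isSetCode]
  refine and_congr_right fun hd => ?_
  rw [Set.not_nonempty_iff_eq_empty, ← Set.disjoint_iff_inter_eq_empty, Set.disjoint_left]
  simp only [mem_models_not, hd, true_and, not_not]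
  rfl

theorem TotalRecIn.forcesCode {f g : ℕ → ℕ}
    (hf : TotalRecIn (chi (TheoryCodes (fun x y : ℕ => x < y) P)) f)
    (hg : TotalRecIn (chi (TheoryCodes (fun x y : ℕ => x < y) P)) g) :
    TotalRecIn (chi (TheoryCodes (fun x y : ℕ => x < y) P)) fun x =>
      forcesCode P (f x) (g x) := by
  have hst := (right.comp totalRecIn_stage).comp hf
  simp only [Nat.unpair_pair] at hst
  exact (const 3).natPair <| (const 6).natPair <| (const 0).natPair <|
    hst.andCode ((const 3).natPair hg)

theorem models_not_and_not_nonempty {c : ℕ} :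
    (Models P (Nat.pair 3 (andCode c (Nat.pair 3 c)))).Nonempty ↔ IsSetCode n c := by
  have h : IsSetCode n (andCode c (Nat.pair 3 c)) ↔ IsSetCode n c := by
    rw [andCode, isSetCode_and, isSetCode_not, and_self]
  constructor
  · rintro ⟨X, hX⟩
    exact h.1 (mem_models_not.1 hX).1
  · intro hc
    refine ⟨∅, mem_models_not.2 ⟨h.2 hc, ?_⟩⟩
    rw [models_andCode]
    exact fun hX => (mem_models_not.1 hX.2).2 hX.1

theorem turingRed_theory_limitSet :
    TuringRed (TheoryCodes (fun x y : ℕ => x < y) (Fin.snoc P (limitSet P) : Fin (n + 1) → Set ℕ))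
      (TheoryCodes (fun x y : ℕ => x < y) P) := by
  classical
  have htr : TotalRecIn (chi (TheoryCodes (fun x y : ℕ => x < y) P)) (lastToVarCode n) :=
    .of_primrec (primrec_lastToVarCode n)
  have hc : TotalRecIn (chi (TheoryCodes (fun x y : ℕ => x < y) P)) fun x =>
      lastToVarCode n x.unpair.1 := htr.comp .left
  have hvalid := (TotalRecIn.const 3).natPair
    (hc.andCode ((TotalRecIn.const 3).natPair hc))
  have hpos := TotalRecIn.right.forcesCode hc
  have hneg := TotalRecIn.right.forcesCode ((TotalRecIn.const 3).natPair hc)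
  have hsearch := hvalid.ite_nonempty
    (hpos.query.ite_eq_zero (hneg.query.ite_eq_zero (.const 1) (.const 0)) (.const 0)) (.const 0)
  obtain ⟨g, hg, hg'⟩ := hsearch.exists_search fun c => by
    simp only [Nat.unpair_pair, models_not_and_not_nonempty]
    by_cases h : IsSetCode n (lastToVarCode n c)
    · obtain ⟨s, hs⟩ := exists_stage_decides (P := P) h
      refine ⟨s, ?_⟩
      rcases hs with hs | hs
      · have : forcesCode P s (lastToVarCode n c) ∈ TheoryCodes (fun x y : ℕ => x < y) P :=
          forcesCode_mem_theory.2 ⟨h, hs⟩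
        simp [this]
      · have : forcesCode P s (Nat.pair 3 (lastToVarCode n c)) ∈
          TheoryCodes (fun x y : ℕ => x < y) P :=
          forcesCode_mem_theory.2 ⟨isSetCode_not.2 h, fun X hX => mem_models_not.2 ⟨h, hs X hX⟩⟩
        simp [this]
    · exact ⟨0, by simp [h]⟩
  simp only [Nat.unpair_pair, models_not_and_not_nonempty] at hg'
  refine RecursiveIn.of_eq (hg.forcesCode htr).query fun c => ?_
  have key : forcesCode P (g c) (lastToVarCode n c) ∈ TheoryCodes (fun x y : ℕ => x < y) P ↔
      c ∈ TheoryCodes (fun x y : ℕ => x < y)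
        (Fin.snoc P (limitSet P) : Fin (n + 1) → Set ℕ) := by
    rw [mem_theoryCodes_snoc]
    constructor
    · exact fun h => (forcesCode_mem_theory.1 h).2 (limitSet_mem_approx _)
    · intro h
      by_contra hcon
      have hcode := isSetCode_of_mem h
      have hc' := hg' c
      rw [if_pos hcode, if_pos (by simp [hcon])] at hc'
      by_cases hn : forcesCode P (g c) (Nat.pair 3 (lastToVarCode n c)) ∈
          TheoryCodes (fun x y : ℕ => x < y) P
      · exact (mem_models_not.1 ((forcesCode_mem_theory.1 hn).2 (limitSet_mem_approx _))).2 h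
      · simp [hn] at hc'
  by_cases h : forcesCode P (g c) (lastToVarCode n c) ∈ TheoryCodes (fun x y : ℕ => x < y) P
  · simp [chi, h, key.1 h]
  · simp [chi, h, mt key.2 h]

end Paper

open Paper

/-- For every labelled linear ordering `M = (ℕ, <, P₁, …, Pₙ)` there is a set
`Q ⊆ ℕ`, not MSO-definable in `M`, such that the MSO theory of the expansion
`M' = (ℕ, <, P₁, …, Pₙ, Q)` is recursive in the MSO theory of `M`; in
particular if `MSO(M)` is decidable then so is `MSO(M')`. -/
theorem stmt_11 {n : ℕ} (P : Fin n → Set ℕ) :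
    ∃ Q : Set ℕ,
      ¬ MSO.Definable (fun x y : ℕ => x < y) P Q ∧
      TuringRed (MSO.TheoryCodes (fun x y : ℕ => x < y) (Fin.snoc P Q))
        (MSO.TheoryCodes (fun x y : ℕ => x < y) P) ∧
      (DecidableSet (MSO.TheoryCodes (fun x y : ℕ => x < y) P) →
        DecidableSet (MSO.TheoryCodes (fun x y : ℕ => x < y) (Fin.snoc P Q))) := by
  exact ⟨limitSet P, not_definable_limitSet, turingRed_theory_limitSet,
    turingRed_theory_limitSet.decidableSet⟩
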